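/- In the backward framework, there exists T* ∈ (0, T̄] such that for all 0 < t₁ ≤ T*: lim_{t₀→0+} ∫_0^{t₁ − t₀} u₊(r + 2t₀, r)² r² dr = ∫_0^{t₁} u₊(r, r)² r² dr; i.e., the integral of u₊² over the translated forward light cone {t = r + 2t₀} converges to its integral over the light cone {t = r} as t₀ → 0. -/

import Mathlib

open Real MeasureTheory Set Filter Topology

/-- Time derivative `u_t`. -/
noncomputable def ut (u : ℝ → ℝ → ℝ) (t r : ℝ) : ℝ := deriv (fun s => u s r) t

/-- Radial derivative `u_r`. -/
noncomputable def ur (u : ℝ → ℝ → ℝ) (t r : ℝ) : ℝ := deriv (fun s => u t s) r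

/-- Second time derivative `u_tt`. -/
noncomputable def utt (u : ℝ → ℝ → ℝ) (t r : ℝ) : ℝ := deriv (fun s => ut u s r) t

/-- Second radial derivative `u_rr`. -/
noncomputable def urr (u : ℝ → ℝ → ℝ) (t r : ℝ) : ℝ := deriv (fun s => ur u t s) r

/-- Null derivative `u₊ = u_t + u_r`. -/
noncomputable def uplus (u : ℝ → ℝ → ℝ) (t r : ℝ) : ℝ := ut u t r + ur u t r

/-- Null derivative `u₋ = u_t - u_r`. -/
noncomputable def uminus (u : ℝ → ℝ → ℝ) (t r : ℝ) : ℝ := ut u t r - ur u t r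

/-- The Adkins–Nappi equivariant wave equation at the point `(t, r)`. -/
def ANeq (u : ℝ → ℝ → ℝ) (t r : ℝ) : Prop :=
  utt u t r - urr u t r - (2 / r) * ur u t r + Real.sin (2 * u t r) / r ^ 2 +
      (u t r - Real.sin (u t r) * Real.cos (u t r)) * (1 - Real.cos (2 * u t r)) / r ^ 4 = 0

/-- The energy density `e(t,r)`. -/
noncomputable def eDens (u : ℝ → ℝ → ℝ) (t r : ℝ) : ℝ :=
  (1 / 2) * (ut u t r ^ 2 + ur u t r ^ 2) + Real.sin (u t r) ^ 2 / r ^ 2 +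
    (u t r - Real.sin (u t r) * Real.cos (u t r)) ^ 2 / (2 * r ^ 4)

/-- The backward domain `D(T̄)`. -/
def Dom (T : ℝ) : Set (ℝ × ℝ) :=
  {p : ℝ × ℝ | 0 < p.1 ∧ p.1 ≤ 2 * T ∧ 0 ≤ p.2 ∧ p.2 ≤ min (2 * T - p.1) p.1}

/-- The local energy `E(t) = ∫_0^t e(t,r) r² dr`. -/
noncomputable def locE (u : ℝ → ℝ → ℝ) (t : ℝ) : ℝ := ∫ r in (0 : ℝ)..t, eDens u t r * r ^ 2

/-- The flux `F(t₀, t₁)` through the light cone `t = r`. -/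
noncomputable def flux (u : ℝ → ℝ → ℝ) (t₀ t₁ : ℝ) : ℝ :=
  ∫ r in t₀..t₁,
    ((1 / 2) * uplus u r r ^ 2 + Real.sin (u r r) ^ 2 / r ^ 2 +
      (u r r - Real.sin (u r r) * Real.cos (u r r)) ^ 2 / (2 * r ^ 4)) * r ^ 2

/-- The backward framework: `u` is smooth on a neighborhood of `D(T̄)`, solves the
Adkins–Nappi equation on `D(T̄)` (for `r > 0`), and has finite energy `E(T̄)`. -/
def BackwardFramework (u : ℝ → ℝ → ℝ) (T : ℝ) : Prop :=
  0 < T ∧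
  (∃ V : Set (ℝ × ℝ), IsOpen V ∧ Dom T ⊆ V ∧
    ContDiffOn ℝ (⊤ : ℕ∞) (fun p : ℝ × ℝ => u p.1 p.2) V) ∧
  (∀ p ∈ Dom T, 0 < p.2 → ANeq u p.1 p.2) ∧
  IntegrableOn (fun r => eDens u T r * r ^ 2) (Set.Ioc 0 T)

/-- The function `x ↦ x - sin x cos x` appearing in the Adkins–Nappi potential. -/
noncomputable def skew (x : ℝ) : ℝ := x - Real.sin x * Real.cos x

/-- Green's inequality for `∂_η A + ∂_ξ B ≤ C` on `ε ≤ ξ ≤ c`, `0 ≤ η ≤ min ξ b`. -/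
lemma green_le {A B A' B' : ℝ → ℝ → ℝ} {ε b c C K : ℝ} (hb : 0 ≤ b) (hεc : ε ≤ c)
    (hbc : b ≤ c) (hε : 0 ≤ ε) (hC : 0 ≤ C)
    (hA : ∀ ξ ∈ Icc ε c, ContinuousOn (A ξ) (Icc 0 (min ξ b)))
    (hB : ∀ η ∈ Icc 0 b, ContinuousOn (fun ξ => B ξ η) (Icc (max ε η) c))
    (hAd : ∀ ξ ∈ Icc ε c, ∀ η ∈ Ioo 0 (min ξ b), HasDerivAt (A ξ) (A' ξ η) η)
    (hBd : ∀ η ∈ Icc 0 b, ∀ ξ ∈ Ioo (max ε η) c, HasDerivAt (fun ξ => B ξ η) (B' ξ η) ξ)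
    (hA'c : ContinuousOn (fun p : ℝ × ℝ => A' p.1 p.2)
      {p | p.1 ∈ Icc ε c ∧ p.2 ∈ Icc 0 b ∧ p.2 < p.1})
    (hB'c : ContinuousOn (fun p : ℝ × ℝ => B' p.1 p.2)
      {p | p.1 ∈ Icc ε c ∧ p.2 ∈ Icc 0 b ∧ p.2 < p.1})
    (hA'K : ∀ ξ ∈ Icc ε c, ∀ η ∈ Icc 0 b, η < ξ → |A' ξ η| ≤ K)
    (hB'K : ∀ ξ ∈ Icc ε c, ∀ η ∈ Icc 0 b, η < ξ → |B' ξ η| ≤ K)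
    (hle : ∀ ξ ∈ Icc ε c, ∀ η ∈ Icc 0 b, η < ξ → A' ξ η + B' ξ η ≤ C) :
    (∫ η in (0 : ℝ)..b, (B c η - B (max ε η) η)) + (∫ ξ in ε..c, (A ξ (min ξ b) - A ξ 0))
      ≤ C * (b * (c - ε)) := by
  set S : Set (ℝ × ℝ) := {p | p.1 ∈ Icc ε c ∧ p.2 ∈ Icc 0 b ∧ p.2 < p.1} with hS
  have hSm : MeasurableSet S := by
    have h1 : MeasurableSet {p : ℝ × ℝ | p.1 ∈ Icc ε c} := measurable_fst measurableSet_Icc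
    have h2 : MeasurableSet {p : ℝ × ℝ | p.2 ∈ Icc 0 b} := measurable_snd measurableSet_Icc
    have h3 : MeasurableSet {p : ℝ × ℝ | p.2 < p.1} :=
      measurableSet_lt measurable_snd measurable_fst
    exact h1.inter (h2.inter h3)
  set α : ℝ × ℝ → ℝ := S.piecewise (fun p => A' p.1 p.2) 0 with hα
  set β : ℝ × ℝ → ℝ := S.piecewise (fun p => B' p.1 p.2) 0 with hβ
  have hαm : Measurable α := hA'c.measurable_piecewise continuousOn_const hSm
  have hβm : Measurable β := hB'c.measurable_piecewise continuousOn_const hSm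
  have hαK : ∀ p, ‖α p‖ ≤ |K| := by
    intro p
    by_cases hp : p ∈ S
    · simp only [hα, hp, piecewise_eq_of_mem, Real.norm_eq_abs]
      exact (hA'K p.1 hp.1 p.2 hp.2.1 hp.2.2).trans (le_abs_self K)
    · simp [hα, hp]
  have hβK : ∀ p, ‖β p‖ ≤ |K| := by
    intro p
    by_cases hp : p ∈ S
    · simp only [hβ, hp, piecewise_eq_of_mem, Real.norm_eq_abs]
      exact (hB'K p.1 hp.1 p.2 hp.2.1 hp.2.2).trans (le_abs_self K)
    · simp [hβ, hp]
  have hαβ : ∀ p, α p + β p ≤ C := by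
    intro p
    by_cases hp : p ∈ S
    · simp only [hα, hβ, hp, piecewise_eq_of_mem]
      exact hle p.1 hp.1 p.2 hp.2.1 hp.2.2
    · simpa [hα, hβ, hp] using hC
  have bddI : ∀ {g : ℝ → ℝ}, Measurable g → (∀ x, ‖g x‖ ≤ |K|) → ∀ x y : ℝ,
      IntervalIntegrable g volume x y := by
    intro g hg hgK x y
    exact (intervalIntegrable_const (c := |K|)).mono_fun' hg.aestronglyMeasurable
      (Eventually.of_forall hgK)
  have sα : ∀ ξ, Measurable fun η => α (ξ, η) := fun ξ => hαm.comp measurable_prodMk_left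
  have sβ : ∀ η, Measurable fun ξ => β (ξ, η) := fun η => hβm.comp measurable_prodMk_right
  have sβ' : ∀ ξ, Measurable fun η => β (ξ, η) := fun ξ => hβm.comp measurable_prodMk_left
  have secA : ∀ ξ ∈ Icc ε c, A ξ (min ξ b) - A ξ 0 = ∫ η in (0 : ℝ)..b, α (ξ, η) := by
    intro ξ hξ
    have h0 : 0 ≤ min ξ b := le_min (hε.trans hξ.1) hb
    rw [← intervalIntegral.integral_add_adjacent_intervals (b := min ξ b)
      (bddI (sα ξ) (fun _ => hαK _) _ _) (bddI (sα ξ) (fun _ => hαK _) _ _)]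
    have hz : ∫ η in (min ξ b)..b, α (ξ, η) = 0 := by
      apply intervalIntegral.integral_zero_ae
      refine Eventually.of_forall fun η hη => ?_
      rw [uIoc_of_le (min_le_right _ _)] at hη
      apply piecewise_eq_of_notMem
      rintro ⟨-, -, h⟩
      rcases min_lt_iff.1 hη.1 with h' | h'
      · exact absurd h (not_lt.2 h'.le)
      · exact absurd hη.2 (not_le.2 h')
    rw [hz, add_zero, intervalIntegral.integral_eq_sub_of_hasDerivAt_of_le h0 (hA ξ hξ) _
      (bddI (sα ξ) (fun _ => hαK _) _ _)]
    intro η hη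
    have : (ξ, η) ∈ S := ⟨hξ, ⟨hη.1.le, (hη.2.trans_le (min_le_right _ _)).le⟩,
      hη.2.trans_le (min_le_left _ _)⟩
    simpa [hα, this] using hAd ξ hξ η hη
  have secB : ∀ η ∈ Icc 0 b, B c η - B (max ε η) η = ∫ ξ in ε..c, β (ξ, η) := by
    intro η hη
    have h0 : max ε η ≤ c := max_le hεc (hη.2.trans hbc)
    rw [← intervalIntegral.integral_add_adjacent_intervals (b := max ε η)
      (bddI (sβ η) (fun _ => hβK _) _ _) (bddI (sβ η) (fun _ => hβK _) _ _)]
    have hz : ∫ ξ in ε..(max ε η), β (ξ, η) = 0 := by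
      apply intervalIntegral.integral_zero_ae
      refine Eventually.of_forall fun ξ hξ => ?_
      rw [uIoc_of_le (le_max_left _ _)] at hξ
      apply piecewise_eq_of_notMem
      rintro ⟨-, -, h⟩
      rcases le_max_iff.1 hξ.2 with h' | h'
      · exact absurd hξ.1 (not_lt.2 h')
      · exact absurd h (not_lt.2 h')
    rw [hz, zero_add, intervalIntegral.integral_eq_sub_of_hasDerivAt_of_le h0 (hB η hη) _
      (bddI (sβ η) (fun _ => hβK _) _ _)]
    intro ξ hξ
    have : (ξ, η) ∈ S := ⟨⟨((le_max_left _ _).trans_lt hξ.1).le, hξ.2.le⟩, hη,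
      (le_max_right _ _).trans_lt hξ.1⟩
    simpa [hβ, this] using hBd η hη ξ hξ
  have e1 : ∫ ξ in ε..c, (A ξ (min ξ b) - A ξ 0) = ∫ ξ in ε..c, ∫ η in (0 : ℝ)..b, α (ξ, η) := by
    apply intervalIntegral.integral_congr
    intro ξ hξ
    rw [uIcc_of_le hεc] at hξ
    exact secA ξ hξ
  have intp : ∀ {g : ℝ × ℝ → ℝ}, Measurable g → (∀ x, ‖g x‖ ≤ |K|) →
      Integrable g ((volume.restrict (Ioc ε c)).prod (volume.restrict (Ioc 0 b))) := by
    intro g hg hgK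
    exact (integrable_const (|K|)).mono' hg.aestronglyMeasurable (Eventually.of_forall hgK)
  have e2 : ∫ η in (0 : ℝ)..b, (B c η - B (max ε η) η)
      = ∫ ξ in ε..c, ∫ η in (0 : ℝ)..b, β (ξ, η) := by
    rw [intervalIntegral.integral_congr (g := fun η => ∫ ξ in ε..c, β (ξ, η))]
    · simp only [intervalIntegral.integral_of_le hεc, intervalIntegral.integral_of_le hb]
      exact (integral_integral_swap (f := fun ξ η => β (ξ, η)) (intp hβm hβK)).symm
    · intro η hη
      rw [uIcc_of_le hb] at hη
      exact secB η hη
  have iα : IntervalIntegrable (fun ξ => ∫ η in (0 : ℝ)..b, α (ξ, η)) volume ε c := by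
    rw [intervalIntegrable_iff_integrableOn_Ioc_of_le hεc]
    simp only [intervalIntegral.integral_of_le hb]
    exact (intp hαm hαK).integral_prod_left
  have iβ : IntervalIntegrable (fun ξ => ∫ η in (0 : ℝ)..b, β (ξ, η)) volume ε c := by
    rw [intervalIntegrable_iff_integrableOn_Ioc_of_le hεc]
    simp only [intervalIntegral.integral_of_le hb]
    exact (intp hβm hβK).integral_prod_left
  rw [e1, e2, ← intervalIntegral.integral_add iβ iα]
  calc _ ≤ ∫ ξ in ε..c, C * b := by
        refine intervalIntegral.integral_mono_on hεc (iβ.add iα) intervalIntegrable_const ?_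
        intro ξ hξ
        rw [← intervalIntegral.integral_add (bddI (sβ' ξ) (fun _ => hβK _) _ _)
          (bddI (sα ξ) (fun _ => hαK _) _ _)]
        calc _ ≤ ∫ η in (0 : ℝ)..b, C := by
              refine intervalIntegral.integral_mono_on hb
                ((bddI (sβ' ξ) (fun _ => hβK _) _ _).add (bddI (sα ξ) (fun _ => hαK _) _ _))
                intervalIntegrable_const ?_
              intro η _
              linarith [hαβ (ξ, η)]
          _ = C * b := by simp [mul_comm]
    _ = C * (b * (c - ε)) := by rw [intervalIntegral.integral_const, smul_eq_mul]; ring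

lemma mul_skew_nonneg (x : ℝ) : 0 ≤ x * skew x := by
  have h : |Real.sin x * Real.cos x| ≤ |x| := by
    rw [abs_mul]
    calc |Real.sin x| * |Real.cos x| ≤ |x| * 1 :=
          mul_le_mul Real.abs_sin_le_abs (Real.abs_cos_le_one x) (abs_nonneg _) (abs_nonneg _)
      _ = |x| := mul_one _
  have h2 : x * (Real.sin x * Real.cos x) ≤ x * x := by
    calc x * (Real.sin x * Real.cos x) ≤ |x * (Real.sin x * Real.cos x)| := le_abs_self _
      _ = |x| * |Real.sin x * Real.cos x| := abs_mul _ _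
      _ ≤ |x| * |x| := by gcongr
      _ = x * x := abs_mul_abs_self x
  unfold skew; nlinarith

lemma skew_sq_add_nonneg (x : ℝ) : 0 ≤ skew x ^ 2 + x * Real.sin (2 * x) := by
  rw [Real.sin_two_mul]
  unfold skew
  have : (x - Real.sin x * Real.cos x) ^ 2 + x * (2 * Real.sin x * Real.cos x)
    = x ^ 2 + (Real.sin x * Real.cos x) ^ 2 := by ring
  rw [this]; positivity

lemma hasDerivAt_skew (x : ℝ) : HasDerivAt skew (1 - Real.cos (2 * x)) x := by
  have := (hasDerivAt_id x).sub ((Real.hasDerivAt_sin x).mul (Real.hasDerivAt_cos x))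
  refine this.congr_deriv ?_
  rw [Real.cos_two_mul]
  have := Real.sin_sq_add_cos_sq x
  nlinarith

lemma continuous_skew : Continuous skew := by unfold skew; fun_prop

lemma one_sub_cos_two_mul_le (x : ℝ) : |1 - Real.cos (2 * x)| ≤ 2 * x ^ 2 := by
  have h := Real.one_sub_sq_div_two_le_cos (x := 2 * x)
  have h1 := Real.cos_le_one (2 * x)
  rw [abs_of_nonneg (by linarith)]; nlinarith

lemma abs_skew_le_cube (x : ℝ) : |skew x| ≤ 2 * |x| ^ 3 := by
  have key : ∀ y ∈ Icc (-|x|) |x|, ‖1 - Real.cos (2 * y)‖ ≤ 2 * |x| ^ 2 := by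
    intro y hy
    rw [Real.norm_eq_abs]
    refine (one_sub_cos_two_mul_le y).trans ?_
    have : |y| ≤ |x| := abs_le.2 hy
    rw [← sq_abs y]
    gcongr
  have := (convex_Icc (-|x|) |x|).norm_image_sub_le_of_norm_hasDerivWithin_le
    (fun y _ => (hasDerivAt_skew y).hasDerivWithinAt) key
    (x := 0) (y := x) ⟨by simp, by simp⟩ ⟨neg_abs_le x, le_abs_self x⟩
  simp only [Real.norm_eq_abs, sub_zero] at this
  have h0 : skew 0 = 0 := by simp [skew]
  rw [h0, sub_zero] at this
  linarith [this, show 2 * |x| ^ 2 * |x| = 2 * |x| ^ 3 by ring]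

lemma eq_zero_of_skew_eq_zero {x : ℝ} (h : skew x = 0) : x = 0 := by
  have h1 : Real.sin x * Real.cos x = x := by unfold skew at h; linarith
  by_contra hx
  have h2 : |Real.sin x| < |x| := Real.abs_sin_lt_abs hx
  have h3 : |Real.sin x * Real.cos x| ≤ |Real.sin x| := by
    rw [abs_mul]
    exact mul_le_of_le_one_right (abs_nonneg _) (Real.abs_cos_le_one x)
  rw [h1] at h3
  linarith

/-- The integrand `N = r ∂W/∂u` of the radial reduction. -/
noncomputable def nonl (u r : ℝ) : ℝ :=
  Real.sin (2 * u) / r + skew u * (1 - Real.cos (2 * u)) / r ^ 3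

/-- The rescaled potential `r² W`. -/
noncomputable def pot (u r : ℝ) : ℝ := Real.sin u ^ 2 + skew u ^ 2 / (2 * r ^ 2)

lemma pot_nonneg (u r : ℝ) : 0 ≤ pot u r := by unfold pot; positivity

/-- `v₊ = r u₊ + u` for `v = r u`. -/
noncomputable def vplus (u : ℝ → ℝ → ℝ) (t r : ℝ) : ℝ := r * uplus u t r + u t r

/-- `v₋ = r u₋ - u` for `v = r u`. -/
noncomputable def vminus (u : ℝ → ℝ → ℝ) (t r : ℝ) : ℝ := r * uminus u t r - u t r

lemma mul_nonl_lower {x r : ℝ} (hr : 0 < r) (hr1 : r ≤ 1 / 2) :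
    skew x ^ 2 / (2 * r ^ 2) ≤ r * (x * nonl x r + skew x ^ 2 / r ^ 3) := by
  have e : r * (x * nonl x r + skew x ^ 2 / r ^ 3) = x * Real.sin (2 * x)
     + (x * skew x) * (1 - Real.cos (2 * x)) / r ^ 2 + skew x ^ 2 / r ^ 2 := by
    unfold nonl; field_simp
  have h1 : 0 ≤ (x * skew x) * (1 - Real.cos (2 * x)) / r ^ 2 := by
    have := mul_skew_nonneg x
    have := Real.cos_le_one (2 * x)
    exact div_nonneg (mul_nonneg ‹_› (by linarith)) (by positivity)
  have h2 := skew_sq_add_nonneg x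
  have h3 : skew x ^ 2 / (2 * r ^ 2) = (skew x ^ 2 / r ^ 2) / 2 := by field_simp
  have h4 : 2 * skew x ^ 2 ≤ skew x ^ 2 / r ^ 2 := by
    rw [le_div_iff₀ (by positivity)]
    have : r ^ 2 ≤ 1 / 4 := by nlinarith
    nlinarith [sq_nonneg (skew x)]
  rw [e, h3]
  nlinarith [sq_nonneg (skew x)]

lemma eventually_ut_ur_eq_fderiv {u : ℝ → ℝ → ℝ} {t r : ℝ}
    (h : ContDiffAt ℝ (⊤ : ℕ∞) (fun p : ℝ × ℝ => u p.1 p.2) (t, r)) :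
    ∀ᶠ p in 𝓝 (t, r), ut u p.1 p.2 = fderiv ℝ (fun p : ℝ × ℝ => u p.1 p.2) p (1, 0) ∧
      ur u p.1 p.2 = fderiv ℝ (fun p : ℝ × ℝ => u p.1 p.2) p (0, 1) := by
  have h1 : ContDiffAt ℝ 1 (fun p : ℝ × ℝ => u p.1 p.2) (t, r) := h.of_le (by exact_mod_cast le_top)
  filter_upwards [h1.eventually (by simp)] with p hp
  have hd : HasFDerivAt (fun p : ℝ × ℝ => u p.1 p.2) _ (p.1, p.2) :=
    (hp.differentiableAt one_ne_zero).hasFDerivAt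
  constructor
  · have : HasDerivAt (fun s : ℝ => (s, p.2)) ((1 : ℝ), (0 : ℝ)) p.1 :=
      (hasDerivAt_id _).prodMk (hasDerivAt_const _ _)
    exact (hd.comp_hasDerivAt p.1 this).deriv
  · have : HasDerivAt (fun s : ℝ => (p.1, s)) ((0 : ℝ), (1 : ℝ)) p.2 :=
      (hasDerivAt_const _ _).prodMk (hasDerivAt_id _)
    exact (hd.comp_hasDerivAt p.2 this).deriv

lemma contDiffAt_ut {u : ℝ → ℝ → ℝ} {t r : ℝ}
    (h : ContDiffAt ℝ (⊤ : ℕ∞) (fun p : ℝ × ℝ => u p.1 p.2) (t, r)) :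
    ContDiffAt ℝ (⊤ : ℕ∞) (fun p : ℝ × ℝ => ut u p.1 p.2) (t, r) :=
  ((h.fderiv_right (m := (⊤ : ℕ∞)) (by simp)).clm_apply contDiffAt_const).congr_of_eventuallyEq
    ((eventually_ut_ur_eq_fderiv h).mono fun _ hp => hp.1)

lemma contDiffAt_ur {u : ℝ → ℝ → ℝ} {t r : ℝ}
    (h : ContDiffAt ℝ (⊤ : ℕ∞) (fun p : ℝ × ℝ => u p.1 p.2) (t, r)) :
    ContDiffAt ℝ (⊤ : ℕ∞) (fun p : ℝ × ℝ => ur u p.1 p.2) (t, r) :=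
  ((h.fderiv_right (m := (⊤ : ℕ∞)) (by simp)).clm_apply contDiffAt_const).congr_of_eventuallyEq
    ((eventually_ut_ur_eq_fderiv h).mono fun _ hp => hp.2)

lemma ur_ut_comm {u : ℝ → ℝ → ℝ} {t r : ℝ}
    (h : ContDiffAt ℝ (⊤ : ℕ∞) (fun p : ℝ × ℝ => u p.1 p.2) (t, r)) :
    ur (ut u) t r = ut (ur u) t r := by
  set U : ℝ × ℝ → ℝ := fun p => u p.1 p.2 with hU
  have hs : IsSymmSndFDerivAt ℝ U (t, r) := h.isSymmSndFDerivAt (by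
    simp only [minSmoothness_of_isRCLikeNormedField]
    exact WithTop.coe_le_coe.2 (le_top (a := (2 : ℕ∞))))
  have hd : DifferentiableAt ℝ (fderiv ℝ U) (t, r) :=
    (h.fderiv_right (m := (⊤ : ℕ∞)) (by simp)).differentiableAt (by simp)
  have e1 : ur (ut u) t r = fderiv ℝ (fderiv ℝ U) (t, r) (0, 1) (1, 0) := by
    rw [(eventually_ut_ur_eq_fderiv (contDiffAt_ut h)).self_of_nhds.2,
      Filter.EventuallyEq.fderiv_eq ((eventually_ut_ur_eq_fderiv h).mono fun _ hp => hp.1),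
      fderiv_clm_apply hd (differentiableAt_const _)]
    simp
  have e2 : ut (ur u) t r = fderiv ℝ (fderiv ℝ U) (t, r) (1, 0) (0, 1) := by
    rw [(eventually_ut_ur_eq_fderiv (contDiffAt_ur h)).self_of_nhds.1,
      Filter.EventuallyEq.fderiv_eq ((eventually_ut_ur_eq_fderiv h).mono fun _ hp => hp.2),
      fderiv_clm_apply hd (differentiableAt_const _)]
    simp
  rw [e1, e2, hs]

lemma hasDerivAt_along {u : ℝ → ℝ → ℝ} {f g : ℝ → ℝ} {f' g' s : ℝ}
    (h : ContDiffAt ℝ (⊤ : ℕ∞) (fun p : ℝ × ℝ => u p.1 p.2) (f s, g s))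
    (hf : HasDerivAt f f' s) (hg : HasDerivAt g g' s) :
    HasDerivAt (fun s => u (f s) (g s)) (ut u (f s) (g s) * f' + ur u (f s) (g s) * g') s := by
  have hd := (h.differentiableAt (by simp)).hasFDerivAt
  have h1 := hd.comp_hasDerivAt s (hf.prodMk hg)
  refine h1.congr_deriv ?_
  have := (eventually_ut_ur_eq_fderiv h).self_of_nhds
  simp only at this
  rw [this.1, this.2]
  have e : (f', g') = f' • ((1 : ℝ), (0 : ℝ)) + g' • ((0 : ℝ), (1 : ℝ)) := by ext <;> simp
  rw [e, map_add, map_smul, map_smul, smul_eq_mul, smul_eq_mul]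
  ring

/-- The solution `u` is smooth and solves the equation on the triangle `0 ≤ η ≤ ξ ≤ c` in null
coordinates `ξ = t + r`, `η = t - r`, away from the origin, and vanishes on the axis. -/
structure ConeRegular (u : ℝ → ℝ → ℝ) (c : ℝ) : Prop where
  pos : 0 < c
  le_one : c ≤ 1
  smooth : ∀ ξ η, 0 < ξ → ξ ≤ c → 0 ≤ η → η ≤ ξ →
    ContDiffAt ℝ (⊤ : ℕ∞) (fun p : ℝ × ℝ => u p.1 p.2) ((ξ + η) / 2, (ξ - η) / 2)
  eqn : ∀ ξ η, 0 < ξ → ξ ≤ c → 0 ≤ η → η < ξ → ANeq u ((ξ + η) / 2) ((ξ - η) / 2)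
  axis : ∀ t, 0 < t → t ≤ c → u t 0 = 0

/-- A function of `(t, r)` expressed in the null coordinates `ξ = t + r`, `η = t - r`. -/
noncomputable def nul (F : ℝ → ℝ → ℝ) (ξ η : ℝ) : ℝ := F ((ξ + η) / 2) ((ξ - η) / 2)

lemma hasDerivAt_nul_left {F : ℝ → ℝ → ℝ} {ξ η : ℝ}
    (h : ContDiffAt ℝ (⊤ : ℕ∞) (fun p : ℝ × ℝ => F p.1 p.2) ((ξ + η) / 2, (ξ - η) / 2)) :
    HasDerivAt (fun ξ => nul F ξ η) (nul (uplus F) ξ η / 2) ξ := by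
  have h1 : HasDerivAt (fun ξ : ℝ => (ξ + η) / 2) (1 / 2) ξ :=
    ((hasDerivAt_id ξ).add_const η).div_const 2
  have h2 : HasDerivAt (fun ξ : ℝ => (ξ - η) / 2) (1 / 2) ξ :=
    ((hasDerivAt_id ξ).sub_const η).div_const 2
  refine (hasDerivAt_along (u := F) (f := fun ξ => (ξ + η) / 2) (g := fun ξ => (ξ - η) / 2)
    h h1 h2).congr_deriv ?_
  simp only [nul, uplus]; ring

lemma hasDerivAt_nul_right {F : ℝ → ℝ → ℝ} {ξ η : ℝ}
    (h : ContDiffAt ℝ (⊤ : ℕ∞) (fun p : ℝ × ℝ => F p.1 p.2) ((ξ + η) / 2, (ξ - η) / 2)) :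
    HasDerivAt (fun η => nul F ξ η) (nul (uminus F) ξ η / 2) η := by
  have h1 : HasDerivAt (fun η : ℝ => (ξ + η) / 2) (1 / 2) η :=
    ((hasDerivAt_id η).const_add ξ).div_const 2
  have h2 : HasDerivAt (fun η : ℝ => (ξ - η) / 2) (-1 / 2) η :=
    ((hasDerivAt_id η).const_sub ξ).div_const 2
  refine (hasDerivAt_along (u := F) (f := fun η => (ξ + η) / 2) (g := fun η => (ξ - η) / 2)
    h h1 h2).congr_deriv ?_
  simp only [nul, uminus]; ring

lemma contDiffAt_uplus {u : ℝ → ℝ → ℝ} {t r : ℝ}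
    (h : ContDiffAt ℝ (⊤ : ℕ∞) (fun p : ℝ × ℝ => u p.1 p.2) (t, r)) :
    ContDiffAt ℝ (⊤ : ℕ∞) (fun p : ℝ × ℝ => uplus u p.1 p.2) (t, r) :=
  (contDiffAt_ut h).add (contDiffAt_ur h)

lemma contDiffAt_uminus {u : ℝ → ℝ → ℝ} {t r : ℝ}
    (h : ContDiffAt ℝ (⊤ : ℕ∞) (fun p : ℝ × ℝ => u p.1 p.2) (t, r)) :
    ContDiffAt ℝ (⊤ : ℕ∞) (fun p : ℝ × ℝ => uminus u p.1 p.2) (t, r) :=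
  (contDiffAt_ut h).sub (contDiffAt_ur h)

lemma uminus_uplus {u : ℝ → ℝ → ℝ} {t r : ℝ}
    (h : ContDiffAt ℝ (⊤ : ℕ∞) (fun p : ℝ × ℝ => u p.1 p.2) (t, r)) :
    uminus (uplus u) t r = utt u t r - urr u t r ∧
      uplus (uminus u) t r = utt u t r - urr u t r := by
  have a : HasDerivAt (fun s => ut u s r) (utt u t r) t :=
    ((hasDerivAt_along (contDiffAt_ut h) (hasDerivAt_id t) (hasDerivAt_const t r)).congr_deriv
      (by simp; rfl))
  have b : HasDerivAt (fun s => ur u s r) (ut (ur u) t r) t :=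
    ((hasDerivAt_along (contDiffAt_ur h) (hasDerivAt_id t) (hasDerivAt_const t r)).congr_deriv
      (by simp))
  have c : HasDerivAt (fun s => ut u t s) (ur (ut u) t r) r :=
    ((hasDerivAt_along (contDiffAt_ut h) (hasDerivAt_const r t) (hasDerivAt_id r)).congr_deriv
      (by simp))
  have d : HasDerivAt (fun s => ur u t s) (urr u t r) r :=
    ((hasDerivAt_along (contDiffAt_ur h) (hasDerivAt_const r t) (hasDerivAt_id r)).congr_deriv
      (by simp; rfl))
  have e := ur_ut_comm h
  have e1 : ut (uplus u) t r = utt u t r + ut (ur u) t r := (a.add b).deriv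
  have e2 : ut (uminus u) t r = utt u t r - ut (ur u) t r := (a.sub b).deriv
  have e3 : ur (uplus u) t r = ur (ut u) t r + urr u t r := (c.add d).deriv
  have e4 : ur (uminus u) t r = ur (ut u) t r - urr u t r := (c.sub d).deriv
  constructor
  · unfold uminus; rw [e1, e3, e]; ring
  · unfold uplus; rw [e2, e4, e]; ring

lemma ANeq.nonl_eq {u : ℝ → ℝ → ℝ} {t r : ℝ} (h : ANeq u t r) (hr : 0 < r) :
    r * (utt u t r - urr u t r) - 2 * ur u t r = - nonl (u t r) r := by
  unfold ANeq at h
  unfold nonl skew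
  field_simp at h ⊢
  linear_combination h

namespace ConeRegular

variable {u : ℝ → ℝ → ℝ} {c : ℝ}

lemma hasDerivAt_vplus (H : ConeRegular u c) {ξ η : ℝ} (h0 : 0 < ξ) (hc : ξ ≤ c) (hη : 0 ≤ η)
    (hlt : η < ξ) :
    HasDerivAt (fun η => nul (vplus u) ξ η) (-(nonl (nul u ξ η) ((ξ - η) / 2)) / 2) η := by
  have hs := H.smooth ξ η h0 hc hη hlt.le
  have h2 : HasDerivAt (fun η : ℝ => (ξ - η) / 2) (-1 / 2) η :=
    ((hasDerivAt_id η).const_sub ξ).div_const 2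
  refine ((h2.mul (hasDerivAt_nul_right (contDiffAt_uplus hs))).add
    (hasDerivAt_nul_right hs)).congr_deriv ?_
  have := (H.eqn ξ η h0 hc hη hlt).nonl_eq (by linarith)
  simp only [nul]
  rw [← this, (uminus_uplus hs).1]
  simp only [uplus, uminus]; ring

lemma hasDerivAt_vminus (H : ConeRegular u c) {ξ η : ℝ} (h0 : 0 < ξ) (hc : ξ ≤ c) (hη : 0 ≤ η)
    (hlt : η < ξ) :
    HasDerivAt (fun ξ => nul (vminus u) ξ η) (-(nonl (nul u ξ η) ((ξ - η) / 2)) / 2) ξ := by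
  have hs := H.smooth ξ η h0 hc hη hlt.le
  have h2 : HasDerivAt (fun ξ : ℝ => (ξ - η) / 2) (1 / 2) ξ :=
    ((hasDerivAt_id ξ).sub_const η).div_const 2
  refine ((h2.mul (hasDerivAt_nul_left (contDiffAt_uminus hs))).sub
    (hasDerivAt_nul_left hs)).congr_deriv ?_
  have := (H.eqn ξ η h0 hc hη hlt).nonl_eq (by linarith)
  simp only [nul]
  rw [← this, (uminus_uplus hs).2]
  simp only [uplus, uminus]; ring

lemma hasDerivAt_pot {f g : ℝ → ℝ} {f' g' s : ℝ} (hf : HasDerivAt f f' s)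
    (hg : HasDerivAt g g' s) (h : g s ≠ 0) :
    HasDerivAt (fun s => pot (f s) (g s))
      (g s * nonl (f s) (g s) * f' - skew (f s) ^ 2 / g s ^ 3 * g') s := by
  have h1 := (hf.sin.pow 2).add (((hasDerivAt_skew (f s)).comp s hf |>.pow 2).div
    ((hg.pow 2).const_mul 2) (by simpa using h))
  refine h1.congr_deriv ?_
  simp only [nonl, Real.sin_two_mul, Function.comp, Pi.pow_apply, Nat.cast_ofNat]
  field_simp
  ring

/-- The triangle `0 ≤ η ≤ ξ ≤ c` without the origin. -/
def tri (c : ℝ) : Set (ℝ × ℝ) := {p | 0 < p.1 ∧ p.1 ≤ c ∧ 0 ≤ p.2 ∧ p.2 ≤ p.1}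

lemma continuousOn_nul {F : ℝ → ℝ → ℝ} {s : Set (ℝ × ℝ)}
    (h : ∀ p ∈ s, ContinuousAt (fun p : ℝ × ℝ => F p.1 p.2)
      ((p.1 + p.2) / 2, (p.1 - p.2) / 2)) :
    ContinuousOn (fun p : ℝ × ℝ => nul F p.1 p.2) s := by
  intro p hp
  have h1 : ContinuousAt (fun p : ℝ × ℝ => ((p.1 + p.2) / 2, (p.1 - p.2) / 2)) p := by fun_prop
  exact (ContinuousAt.comp (f := fun p : ℝ × ℝ => ((p.1 + p.2) / 2, (p.1 - p.2) / 2))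
    (h p hp) h1).continuousWithinAt

lemma continuousOn_u (H : ConeRegular u c) :
    ContinuousOn (fun p : ℝ × ℝ => nul u p.1 p.2) (tri c) :=
  continuousOn_nul fun p hp => (H.smooth p.1 p.2 hp.1 hp.2.1 hp.2.2.1 hp.2.2.2).continuousAt

lemma continuousOn_uplus (H : ConeRegular u c) :
    ContinuousOn (fun p : ℝ × ℝ => nul (uplus u) p.1 p.2) (tri c) :=
  continuousOn_nul fun p hp =>
    (contDiffAt_uplus (H.smooth p.1 p.2 hp.1 hp.2.1 hp.2.2.1 hp.2.2.2)).continuousAt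

lemma continuousOn_uminus (H : ConeRegular u c) :
    ContinuousOn (fun p : ℝ × ℝ => nul (uminus u) p.1 p.2) (tri c) :=
  continuousOn_nul fun p hp =>
    (contDiffAt_uminus (H.smooth p.1 p.2 hp.1 hp.2.1 hp.2.2.1 hp.2.2.2)).continuousAt

lemma continuousOn_vplus (H : ConeRegular u c) :
    ContinuousOn (fun p : ℝ × ℝ => nul (vplus u) p.1 p.2) (tri c) :=
  ((by fun_prop : Continuous fun p : ℝ × ℝ => (p.1 - p.2) / 2).continuousOn.mul
    H.continuousOn_uplus).add H.continuousOn_u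

lemma continuousOn_vminus (H : ConeRegular u c) :
    ContinuousOn (fun p : ℝ × ℝ => nul (vminus u) p.1 p.2) (tri c) :=
  ((by fun_prop : Continuous fun p : ℝ × ℝ => (p.1 - p.2) / 2).continuousOn.mul
    H.continuousOn_uminus).sub H.continuousOn_u

lemma nul_diag (H : ConeRegular u c) {ξ : ℝ} (h0 : 0 < ξ) (hc : ξ ≤ c) : nul u ξ ξ = 0 := by
  simpa [nul] using H.axis ξ h0 hc

lemma isCompact_tri (ε c : ℝ) :
    IsCompact {p : ℝ × ℝ | p.1 ∈ Icc ε c ∧ 0 ≤ p.2 ∧ p.2 ≤ p.1} := by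
  refine (isCompact_Icc (a := ε) (b := c)).prod (isCompact_Icc (a := 0) (b := c))
    |>.of_isClosed_subset ?_ ?_
  · refine (isClosed_Icc.preimage continuous_fst).inter ?_
    exact (isClosed_le continuous_const continuous_snd).inter
      (isClosed_le continuous_snd continuous_fst)
  · rintro p ⟨h1, h2, h3⟩
    exact ⟨h1, h2, h3.trans h1.2⟩

lemma exists_bound {f : ℝ × ℝ → ℝ} (hf : ContinuousOn f (tri c)) {ε : ℝ} (hε : 0 < ε) :
    ∃ K, 0 ≤ K ∧ ∀ ξ η, ε ≤ ξ → ξ ≤ c → 0 ≤ η → η ≤ ξ → |f (ξ, η)| ≤ K := by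
  obtain ⟨K, hK⟩ := (isCompact_tri ε c).exists_bound_of_continuousOn
    (hf.mono fun p hp => ⟨hε.trans_le hp.1.1, hp.1.2, hp.2⟩)
  refine ⟨|K|, abs_nonneg _, fun ξ η h1 h2 h3 h4 => ?_⟩
  exact (hK (ξ, η) ⟨⟨h1, h2⟩, h3, h4⟩).trans (le_abs_self K)

lemma exists_abs_le_mul (H : ConeRegular u c) {ε : ℝ} (hε : 0 < ε) :
    ∃ C, 0 ≤ C ∧ ∀ ξ η, ε ≤ ξ → ξ ≤ c → 0 ≤ η → η ≤ ξ → |nul u ξ η| ≤ C * ((ξ - η) / 2) := by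
  obtain ⟨K, hK0, hK⟩ := exists_bound H.continuousOn_uminus hε
  refine ⟨K, hK0, fun ξ η h1 h2 h3 h4 => ?_⟩
  have := (convex_Icc η ξ).norm_image_sub_le_of_norm_hasDerivWithin_le (C := K / 2)
    (f := fun η => nul u ξ η) (fun y hy => (hasDerivAt_nul_right (H.smooth ξ y
      (hε.trans_le h1) h2 (h3.trans hy.1) hy.2)).hasDerivWithinAt) (fun y hy => by
        have := hK ξ y h1 h2 (h3.trans hy.1) hy.2
        rw [Real.norm_eq_abs, abs_div, abs_two]
        simp only at this
        linarith) (right_mem_Icc.2 h4) (left_mem_Icc.2 h4)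
  rw [H.nul_diag (hε.trans_le h1) h2, sub_zero, Real.norm_eq_abs, Real.norm_eq_abs,
    abs_sub_comm, abs_of_nonneg (sub_nonneg.2 h4)] at this
  linarith

lemma skew_sq_le {x r C : ℝ} (h : |x| ≤ C * r) : skew x ^ 2 ≤ 4 * C ^ 6 * r ^ 6 := by
  have h1 : |skew x| ≤ 2 * (C * r) ^ 3 := (abs_skew_le_cube x).trans (by gcongr)
  rw [← sq_abs]
  calc |skew x| ^ 2 ≤ (2 * (C * r) ^ 3) ^ 2 := by gcongr
    _ = _ := by ring

lemma pot_le {x r C : ℝ} (hr : 0 ≤ r) (hr1 : r ≤ 1) (h : |x| ≤ C * r) :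
    pot x r ≤ (C ^ 2 + 2 * C ^ 6) * r ^ 2 := by
  rcases hr.eq_or_lt with rfl | hr
  · have : x = 0 := by simpa using h
    simp [pot, this]
  have h1 : Real.sin x ^ 2 ≤ C ^ 2 * r ^ 2 := by
    rw [← sq_abs, ← mul_pow]
    have := Real.abs_sin_le_abs (x := x)
    gcongr
    exact this.trans h
  have h2 : skew x ^ 2 / (2 * r ^ 2) ≤ 2 * C ^ 6 * r ^ 2 := by
    rw [div_le_iff₀ (by positivity)]
    refine (skew_sq_le h).trans ?_
    have : r ^ 6 ≤ r ^ 4 := pow_le_pow_of_le_one hr.le hr1 (by norm_num)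
    nlinarith [pow_nonneg (sq_nonneg C) 3, show C ^ 6 = (C ^ 2) ^ 3 by ring]
  unfold pot; linarith

lemma abs_nonl_le {x r C : ℝ} (hC : 0 ≤ C) (hr : 0 < r) (hr1 : r ≤ 1) (h : |x| ≤ C * r) :
    |nonl x r| ≤ 2 * C + 4 * C ^ 5 := by
  have h1 : |Real.sin (2 * x) / r| ≤ 2 * C := by
    rw [abs_div, abs_of_pos hr, div_le_iff₀ hr]
    have := Real.abs_sin_le_abs (x := 2 * x)
    rw [abs_mul, abs_two] at this
    linarith
  have h2 : |skew x * (1 - Real.cos (2 * x)) / r ^ 3| ≤ 4 * C ^ 5 := by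
    rw [abs_div, abs_mul, abs_of_pos (pow_pos hr 3), div_le_iff₀ (by positivity)]
    have a := (abs_skew_le_cube x).trans (by gcongr : 2 * |x| ^ 3 ≤ 2 * (C * r) ^ 3)
    have b := (one_sub_cos_two_mul_le x).trans
      (by rw [← sq_abs]; gcongr : 2 * x ^ 2 ≤ 2 * (C * r) ^ 2)
    calc _ ≤ (2 * (C * r) ^ 3) * (2 * (C * r) ^ 2) := by gcongr
      _ = 4 * C ^ 5 * r ^ 3 * r ^ 2 := by ring
      _ ≤ 4 * C ^ 5 * r ^ 3 * 1 := by gcongr; exact pow_le_one₀ hr.le hr1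
      _ = _ := by ring
  exact (abs_add_le _ _).trans (add_le_add h1 h2)

lemma skew_sq_div_le {x r C : ℝ} (hr : 0 < r) (hr1 : r ≤ 1) (h : |x| ≤ C * r) :
    skew x ^ 2 / r ^ 3 ≤ 4 * C ^ 6 := by
  rw [div_le_iff₀ (by positivity)]
  refine (skew_sq_le h).trans ?_
  have : r ^ 6 ≤ r ^ 3 := pow_le_pow_of_le_one hr.le hr1 (by norm_num)
  nlinarith [pow_nonneg (sq_nonneg C) 3, show C ^ 6 = (C ^ 2) ^ 3 by ring]

lemma continuousOn_pot (H : ConeRegular u c) :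
    ContinuousOn (fun p : ℝ × ℝ => pot (nul u p.1 p.2) ((p.1 - p.2) / 2)) (tri c) := by
  have hu := H.continuousOn_u
  intro p hp
  rcases hp.2.2.2.eq_or_lt with hd | hlt
  · obtain ⟨C, hC, hb⟩ := H.exists_abs_le_mul (half_pos hp.1)
    have hz : pot (nul u p.1 p.2) ((p.1 - p.2) / 2) = 0 := by
      rw [hd, H.nul_diag hp.1 hp.2.1]; simp [pot, skew]
    have hev : ∀ᶠ q in 𝓝[tri c] p, pot (nul u q.1 q.2) ((q.1 - q.2) / 2)
        ≤ (C ^ 2 + 2 * C ^ 6) * ((q.1 - q.2) / 2) ^ 2 := by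
      have h1 : ∀ᶠ q : ℝ × ℝ in 𝓝[tri c] p, p.1 / 2 < q.1 :=
        nhdsWithin_le_nhds (continuous_fst.continuousAt.eventually
          (lt_mem_nhds (half_lt_self hp.1)))
      filter_upwards [h1, self_mem_nhdsWithin] with q hq hqs
      have := H.le_one
      exact pot_le (by linarith [hqs.2.2.2]) (by linarith [hqs.2.1, hqs.2.2.1])
        (hb q.1 q.2 hq.le hqs.2.1 hqs.2.2.1 hqs.2.2.2)
    have hlim : Tendsto (fun q : ℝ × ℝ => (C ^ 2 + 2 * C ^ 6) * ((q.1 - q.2) / 2) ^ 2)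
        (𝓝[tri c] p) (𝓝 0) := by
      have : Continuous fun q : ℝ × ℝ => (C ^ 2 + 2 * C ^ 6) * ((q.1 - q.2) / 2) ^ 2 := by
        fun_prop
      have := (this.tendsto p).mono_left (nhdsWithin_le_nhds (s := tri c))
      simpa [hd] using this
    show Tendsto _ _ (𝓝 (pot (nul u p.1 p.2) ((p.1 - p.2) / 2)))
    rw [hz]
    exact squeeze_zero' (Eventually.of_forall fun q => pot_nonneg _ _) hev hlim
  · have h2 : ContinuousWithinAt (fun p : ℝ × ℝ => 2 * ((p.1 - p.2) / 2) ^ 2) (tri c) p := by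
      fun_prop
    have hsk := continuous_skew.continuousAt.comp_continuousWithinAt (hu p hp)
    have hsn := Real.continuous_sin.continuousAt.comp_continuousWithinAt (hu p hp)
    refine (hsn.pow 2).add ((hsk.pow 2).div h2 ?_)
    have : p.1 - p.2 ≠ 0 := by linarith
    positivity

lemma continuousOn_nonl (H : ConeRegular u c) :
    ContinuousOn (fun p : ℝ × ℝ => nonl (nul u p.1 p.2) ((p.1 - p.2) / 2))
      (tri c ∩ {p | p.2 < p.1}) := by
  have hu := H.continuousOn_u.mono (inter_subset_left (t := {p | p.2 < p.1}))
  have hr : ContinuousOn (fun p : ℝ × ℝ => (p.1 - p.2) / 2) (tri c ∩ {p | p.2 < p.1}) := by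
    fun_prop
  have hne : ∀ p ∈ tri c ∩ {p | p.2 < p.1}, (p.1 - p.2) / 2 ≠ 0 := fun p hp => by
    have : p.2 < p.1 := hp.2
    have : p.1 - p.2 ≠ 0 := by linarith
    positivity
  have h2 := hu.const_smul (2 : ℝ)
  exact ((Real.continuous_sin.comp_continuousOn h2).div hr hne).add
    (((continuous_skew.comp_continuousOn hu).mul
      (continuousOn_const.sub (Real.continuous_cos.comp_continuousOn h2))).div (hr.pow 3)
        fun p hp => pow_ne_zero 3 (hne p hp))

lemma continuousOn_skew_sq_div (H : ConeRegular u c) :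
    ContinuousOn (fun p : ℝ × ℝ => skew (nul u p.1 p.2) ^ 2 / ((p.1 - p.2) / 2) ^ 3)
      (tri c ∩ {p | p.2 < p.1}) := by
  have hu := H.continuousOn_u.mono (inter_subset_left (t := {p | p.2 < p.1}))
  have hr : ContinuousOn (fun p : ℝ × ℝ => (p.1 - p.2) / 2) (tri c ∩ {p | p.2 < p.1}) := by
    fun_prop
  refine ((continuous_skew.comp_continuousOn hu).pow 2).div (hr.pow 3) fun p hp => ?_
  have : p.2 < p.1 := hp.2
  have : p.1 - p.2 ≠ 0 := by linarith
  positivity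


/-- The rescaled potential along the solution, in null coordinates. -/
noncomputable def npot (u : ℝ → ℝ → ℝ) (ξ η : ℝ) : ℝ := pot (nul u ξ η) ((ξ - η) / 2)

lemma npot_nonneg (u : ℝ → ℝ → ℝ) (ξ η : ℝ) : 0 ≤ npot u ξ η := pot_nonneg _ _

lemma hasDerivAt_npot_left (H : ConeRegular u c) {ξ η : ℝ} (h0 : 0 < ξ) (hc : ξ ≤ c)
    (hη : 0 ≤ η) (hlt : η < ξ) :
    HasDerivAt (fun ξ => npot u ξ η) (((ξ - η) / 2 * nul (uplus u) ξ η *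
      nonl (nul u ξ η) ((ξ - η) / 2) - skew (nul u ξ η) ^ 2 / ((ξ - η) / 2) ^ 3) / 2) ξ := by
  have h2 : HasDerivAt (fun ξ : ℝ => (ξ - η) / 2) (1 / 2) ξ :=
    ((hasDerivAt_id ξ).sub_const η).div_const 2
  refine (hasDerivAt_pot (hasDerivAt_nul_left (H.smooth ξ η h0 hc hη hlt.le)) h2
    (by linarith)).congr_deriv ?_
  ring

lemma hasDerivAt_npot_right (H : ConeRegular u c) {ξ η : ℝ} (h0 : 0 < ξ) (hc : ξ ≤ c)
    (hη : 0 ≤ η) (hlt : η < ξ) :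
    HasDerivAt (fun η => npot u ξ η) (((ξ - η) / 2 * nul (uminus u) ξ η *
      nonl (nul u ξ η) ((ξ - η) / 2) + skew (nul u ξ η) ^ 2 / ((ξ - η) / 2) ^ 3) / 2) η := by
  have h2 : HasDerivAt (fun η : ℝ => (ξ - η) / 2) (-1 / 2) η :=
    ((hasDerivAt_id η).const_sub ξ).div_const 2
  refine (hasDerivAt_pot (hasDerivAt_nul_right (H.smooth ξ η h0 hc hη hlt.le)) h2
    (by linarith)).congr_deriv ?_
  ring

lemma abs_mul_le_mul {a b x y : ℝ} (ha : |a| ≤ x) (hb : |b| ≤ y) : |a * b| ≤ x * y := by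
  rw [abs_mul]
  exact mul_le_mul ha hb (abs_nonneg _) ((abs_nonneg _).trans ha)

lemma exists_common_bound (H : ConeRegular u c) {ε : ℝ} (hε : 0 < ε) :
    ∃ M, 0 ≤ M ∧ ∀ ξ η, ε ≤ ξ → ξ ≤ c → 0 ≤ η → η < ξ →
      |nul (vplus u) ξ η| ≤ M ∧ |nul (vminus u) ξ η| ≤ M ∧
      |(ξ - η) / 2 * nul (uplus u) ξ η| ≤ M ∧ |(ξ - η) / 2 * nul (uminus u) ξ η| ≤ M ∧
      |npot u ξ η| ≤ M ∧ |nonl (nul u ξ η) ((ξ - η) / 2)| ≤ M ∧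
      |skew (nul u ξ η) ^ 2 / ((ξ - η) / 2) ^ 3| ≤ M := by
  obtain ⟨M1, h10, h1⟩ := exists_bound H.continuousOn_vplus hε
  obtain ⟨M2, h20, h2⟩ := exists_bound H.continuousOn_vminus hε
  obtain ⟨M3, h30, h3⟩ := exists_bound H.continuousOn_uplus hε
  obtain ⟨M4, h40, h4⟩ := exists_bound H.continuousOn_uminus hε
  obtain ⟨M5, h50, h5⟩ := exists_bound H.continuousOn_pot hε
  obtain ⟨C, hC, h6⟩ := H.exists_abs_le_mul hε
  have hC6 : 0 ≤ 4 * C ^ 6 := by positivity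
  have hC5 : 0 ≤ 2 * C + 4 * C ^ 5 := by positivity
  refine ⟨M1 + M2 + M3 + M4 + M5 + (2 * C + 4 * C ^ 5) + 4 * C ^ 6, by linarith, ?_⟩
  intro ξ η hξ hξc hη hlt
  have hr : 0 < (ξ - η) / 2 := by linarith
  have hr1 : (ξ - η) / 2 ≤ 1 := by linarith [H.le_one]
  have hra : |(ξ - η) / 2| ≤ 1 := by rwa [abs_of_pos hr]
  have a1 := h1 ξ η hξ hξc hη hlt.le
  have a2 := h2 ξ η hξ hξc hη hlt.le
  have a3 := abs_mul_le_mul hra (h3 ξ η hξ hξc hη hlt.le)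
  have a4 := abs_mul_le_mul hra (h4 ξ η hξ hξc hη hlt.le)
  have a5 := h5 ξ η hξ hξc hη hlt.le
  have a6 := abs_nonl_le hC hr hr1 (h6 ξ η hξ hξc hη hlt.le)
  have a7 := skew_sq_div_le hr hr1 (h6 ξ η hξ hξc hη hlt.le)
  rw [← abs_of_nonneg (show 0 ≤ skew (nul u ξ η) ^ 2 / ((ξ - η) / 2) ^ 3 by positivity)] at a7
  simp only at a1 a2 a3 a4 a5
  unfold npot
  refine ⟨?_, ?_, ?_, ?_, ?_, ?_, ?_⟩ <;> linarith

/-- Green's inequality for the weighted null energy currents of a solution. -/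
lemma green_cone (H : ConeRegular u c) {k₀ k₁ k₂ ε b c' C : ℝ} (hb : 0 ≤ b) (hε : 0 < ε)
    (hεc : ε ≤ c') (hbc : b ≤ c') (hc : c' ≤ c) (hC : 0 ≤ C)
    (hk : ∀ ξ η, ε ≤ ξ → ξ ≤ c' → 0 ≤ η → η ≤ b → η < ξ →
      k₁ * npot u ξ η - (k₀ + k₁ * ξ - k₂) / 2 * (nul u ξ η * nonl (nul u ξ η) ((ξ - η) / 2) +
        skew (nul u ξ η) ^ 2 / ((ξ - η) / 2) ^ 3) ≤ C) :
    (∫ η in (0 : ℝ)..b, ((k₂ * (nul (vminus u) c' η ^ 2 / 2) + (k₀ + k₁ * c') * npot u c' η) -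
        (k₂ * (nul (vminus u) (max ε η) η ^ 2 / 2) +
          (k₀ + k₁ * max ε η) * npot u (max ε η) η))) +
      (∫ ξ in ε..c', (((k₀ + k₁ * ξ) * (nul (vplus u) ξ (min ξ b) ^ 2 / 2) +
          k₂ * npot u ξ (min ξ b)) -
        ((k₀ + k₁ * ξ) * (nul (vplus u) ξ 0 ^ 2 / 2) + k₂ * npot u ξ 0))) ≤
      C * (b * (c' - ε)) := by
  obtain ⟨M, hM, hMb⟩ := H.exists_common_bound hε
  set L : ℝ := |k₀| + |k₁| + |k₂| with hL
  have hL0 : 0 ≤ L := by positivity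
  have hcl : ∀ {ξ}, ξ ≤ c' → ξ ≤ c := fun h => h.trans hc
  have hkL : ∀ ξ ∈ Icc ε c', |k₀ + k₁ * ξ| ≤ L := by
    intro ξ hξ
    have h1 : |k₁ * ξ| ≤ |k₁| * 1 := abs_mul_le_mul le_rfl (by
      rw [abs_of_pos (hε.trans_le hξ.1)]
      exact (hcl hξ.2).trans H.le_one)
    refine (abs_add_le _ _).trans ?_
    linarith [abs_nonneg k₂]
  have hk1 : |k₁| ≤ L := by linarith [abs_nonneg k₂, abs_nonneg k₀]
  have hk2 : |k₂| ≤ L := by linarith [abs_nonneg k₁, abs_nonneg k₀]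
  have hsub : {p : ℝ × ℝ | p.1 ∈ Icc ε c' ∧ p.2 ∈ Icc 0 b ∧ p.2 < p.1} ⊆
      tri c ∩ {p | p.2 < p.1} := fun p hp =>
    ⟨⟨hε.trans_le hp.1.1, hcl hp.1.2, hp.2.1.1, hp.2.2.le⟩, hp.2.2⟩
  have hsub' := hsub.trans inter_subset_left
  have cN := H.continuousOn_nonl.mono hsub
  have cS := H.continuousOn_skew_sq_div.mono hsub
  have cP : ContinuousOn (fun p : ℝ × ℝ => npot u p.1 p.2) (tri c) := H.continuousOn_pot
  have cr : Continuous fun p : ℝ × ℝ => (p.1 - p.2) / 2 := by fun_prop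
  have ck : Continuous fun p : ℝ × ℝ => k₀ + k₁ * p.1 := by fun_prop
  have lineA : ∀ ξ ∈ Icc ε c', ContinuousOn (fun η : ℝ => (ξ, η)) (Icc 0 (min ξ b)) ∧
      MapsTo (fun η : ℝ => (ξ, η)) (Icc 0 (min ξ b)) (tri c) := fun ξ hξ =>
    ⟨by fun_prop, fun η hη => ⟨hε.trans_le hξ.1, hcl hξ.2, hη.1, hη.2.trans (min_le_left _ _)⟩⟩
  have lineB : ∀ η ∈ Icc 0 b, ContinuousOn (fun ξ : ℝ => (ξ, η)) (Icc (max ε η) c') ∧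
      MapsTo (fun ξ : ℝ => (ξ, η)) (Icc (max ε η) c') (tri c) := fun η hη =>
    ⟨by fun_prop, fun ξ hξ => ⟨hε.trans_le ((le_max_left _ _).trans hξ.1), hcl hξ.2, hη.1,
      (le_max_right _ _).trans hξ.1⟩⟩
  refine green_le (K := L * (M * M) + L * (M * M + M) + L * M)
    (A := fun ξ η => (k₀ + k₁ * ξ) * (nul (vplus u) ξ η ^ 2 / 2) + k₂ * npot u ξ η)
    (B := fun ξ η => k₂ * (nul (vminus u) ξ η ^ 2 / 2) + (k₀ + k₁ * ξ) * npot u ξ η)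
    (A' := fun ξ η => (k₀ + k₁ * ξ) *
        (nul (vplus u) ξ η * (-(nonl (nul u ξ η) ((ξ - η) / 2)) / 2)) +
      k₂ * (((ξ - η) / 2 * nul (uminus u) ξ η *
        nonl (nul u ξ η) ((ξ - η) / 2) + skew (nul u ξ η) ^ 2 / ((ξ - η) / 2) ^ 3) / 2))
    (B' := fun ξ η => k₂ *
        (nul (vminus u) ξ η * (-(nonl (nul u ξ η) ((ξ - η) / 2)) / 2)) +
      (k₁ * npot u ξ η + (k₀ + k₁ * ξ) * (((ξ - η) / 2 * nul (uplus u) ξ η *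
        nonl (nul u ξ η) ((ξ - η) / 2) - skew (nul u ξ η) ^ 2 / ((ξ - η) / 2) ^ 3) / 2)))
    hb hεc hbc hε.le hC ?_ ?_ ?_ ?_ ?_ ?_ ?_ ?_ ?_
  · intro ξ hξ
    obtain ⟨h1, h2⟩ := lineA ξ hξ
    have e1 : ContinuousOn (fun η => nul (vplus u) ξ η) (Icc 0 (min ξ b)) :=
      H.continuousOn_vplus.comp h1 h2
    have e2 : ContinuousOn (fun η => npot u ξ η) (Icc 0 (min ξ b)) :=
      ContinuousOn.comp (g := fun p : ℝ × ℝ => npot u p.1 p.2) (f := fun η : ℝ => (ξ, η)) cP h1 h2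
    fun_prop
  · intro η hη
    obtain ⟨h1, h2⟩ := lineB η hη
    have e1 : ContinuousOn (fun ξ => nul (vminus u) ξ η) (Icc (max ε η) c') :=
      H.continuousOn_vminus.comp h1 h2
    have e2 : ContinuousOn (fun ξ => npot u ξ η) (Icc (max ε η) c') :=
      ContinuousOn.comp (g := fun p : ℝ × ℝ => npot u p.1 p.2) (f := fun ξ : ℝ => (ξ, η)) cP h1 h2
    fun_prop
  · intro ξ hξ η hη
    have h0 := hε.trans_le hξ.1
    have hlt := hη.2.trans_le (min_le_left _ _)
    have := (((H.hasDerivAt_vplus h0 (hcl hξ.2) hη.1.le hlt).pow 2).div_const 2 |>.const_mul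
      (k₀ + k₁ * ξ)).add ((H.hasDerivAt_npot_right h0 (hcl hξ.2) hη.1.le hlt).const_mul k₂)
    refine this.congr_deriv ?_
    simp only [Nat.cast_ofNat]; ring
  · intro η hη ξ hξ
    have h0 := hε.trans ((le_max_left _ _).trans_lt hξ.1)
    have hlt := (le_max_right _ _).trans_lt hξ.1
    have hk' : HasDerivAt (fun ξ => k₀ + k₁ * ξ) k₁ ξ := by
      simpa using ((hasDerivAt_id ξ).const_mul k₁).const_add k₀
    have := (((H.hasDerivAt_vminus h0 (hcl hξ.2.le) hη.1 hlt).pow 2).div_const 2 |>.const_mul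
      k₂).add (hk'.mul (H.hasDerivAt_npot_left h0 (hcl hξ.2.le) hη.1 hlt))
    refine this.congr_deriv ?_
    simp only [Nat.cast_ofNat]; ring
  · exact (ck.continuousOn.mul ((H.continuousOn_vplus.mono hsub').mul (cN.neg.div_const 2))).add
      (continuousOn_const.mul (((((cr.continuousOn.mul (H.continuousOn_uminus.mono hsub')).mul
        cN)).add cS).div_const 2))
  · exact (continuousOn_const.mul ((H.continuousOn_vminus.mono hsub').mul
      (cN.neg.div_const 2))).add
      ((continuousOn_const.mul (cP.mono hsub')).add (ck.continuousOn.mul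
        (((((cr.continuousOn.mul (H.continuousOn_uplus.mono hsub')).mul cN)).sub cS).div_const 2)))
  · intro ξ hξ η hη hlt
    obtain ⟨h1, -, -, h4, -, h6, h7⟩ := hMb ξ η hξ.1 (hcl hξ.2) hη.1 hlt
    have e1 := abs_mul_le_mul (hkL ξ hξ) (abs_mul_le_mul h1 h6)
    have e2 := abs_mul_le_mul hk2 ((abs_add_le _ _).trans (add_le_add (abs_mul_le_mul h4 h6) h7))
    rw [abs_le] at e1 e2 ⊢
    have : 0 ≤ L * M := by positivity
    have : 0 ≤ L * (M * M) := by positivity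
    constructor <;> nlinarith
  · intro ξ hξ η hη hlt
    obtain ⟨-, h2, h3, -, h5, h6, h7⟩ := hMb ξ η hξ.1 (hcl hξ.2) hη.1 hlt
    have e1 := abs_mul_le_mul hk2 (abs_mul_le_mul h2 h6)
    have e2 := abs_mul_le_mul (hkL ξ hξ) ((abs_sub _ _).trans
      (add_le_add (abs_mul_le_mul h3 h6) h7))
    have e3 := abs_mul_le_mul hk1 h5
    rw [abs_le] at e1 e2 e3 ⊢
    have : 0 ≤ L * M := by positivity
    have : 0 ≤ L * (M * M) := by positivity
    constructor <;> nlinarith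
  · intro ξ hξ η hη hlt
    refine le_trans (le_of_eq ?_) (hk ξ η hξ.1 hξ.2 hη.1 hη.2 hlt)
    simp only [nul, vplus, vminus]
    ring

lemma npot_diag (H : ConeRegular u c) {ξ : ℝ} (h0 : 0 < ξ) (hc : ξ ≤ c) : npot u ξ ξ = 0 := by
  simp [npot, H.nul_diag h0 hc, pot, skew]

lemma vplus_diag (H : ConeRegular u c) {ξ : ℝ} (h0 : 0 < ξ) (hc : ξ ≤ c) :
    nul (vplus u) ξ ξ = 0 := by
  have := H.axis ξ h0 hc
  simp [nul, vplus, this]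

lemma vminus_diag (H : ConeRegular u c) {ξ : ℝ} (h0 : 0 < ξ) (hc : ξ ≤ c) :
    nul (vminus u) ξ ξ = 0 := by
  have := H.axis ξ h0 hc
  simp [nul, vminus, this]

lemma continuousOn_npot_row (H : ConeRegular u c) {ξ : ℝ} (h0 : 0 < ξ) (hc : ξ ≤ c) :
    ContinuousOn (fun η => npot u ξ η) (Icc 0 ξ) :=
  ContinuousOn.comp (g := fun p : ℝ × ℝ => npot u p.1 p.2) (f := fun η : ℝ => (ξ, η))
    H.continuousOn_pot (by fun_prop) fun _ hη => ⟨h0, hc, hη.1, hη.2⟩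

lemma continuousOn_vminus_row (H : ConeRegular u c) {ξ : ℝ} (h0 : 0 < ξ) (hc : ξ ≤ c) :
    ContinuousOn (fun η => nul (vminus u) ξ η) (Icc 0 ξ) :=
  ContinuousOn.comp (g := fun p : ℝ × ℝ => nul (vminus u) p.1 p.2) (f := fun η : ℝ => (ξ, η))
    H.continuousOn_vminus (by fun_prop) fun _ hη => ⟨h0, hc, hη.1, hη.2⟩

lemma continuousOn_vplus_col (H : ConeRegular u c) {b : ℝ} (hb : 0 ≤ b) {s : Set ℝ}
    (hs : ∀ ξ ∈ s, 0 < ξ ∧ b ≤ ξ ∧ ξ ≤ c) :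
    ContinuousOn (fun ξ => nul (vplus u) ξ b) s :=
  ContinuousOn.comp (g := fun p : ℝ × ℝ => nul (vplus u) p.1 p.2) (f := fun ξ : ℝ => (ξ, b))
    H.continuousOn_vplus (by fun_prop) fun ξ hξ => ⟨(hs ξ hξ).1, (hs ξ hξ).2.2, hb, (hs ξ hξ).2.1⟩

lemma continuousOn_npot_col (H : ConeRegular u c) {b : ℝ} (hb : 0 ≤ b) {s : Set ℝ}
    (hs : ∀ ξ ∈ s, 0 < ξ ∧ b ≤ ξ ∧ ξ ≤ c) :
    ContinuousOn (fun ξ => npot u ξ b) s :=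
  ContinuousOn.comp (g := fun p : ℝ × ℝ => npot u p.1 p.2) (f := fun ξ : ℝ => (ξ, b))
    H.continuousOn_pot (by fun_prop) fun ξ hξ => ⟨(hs ξ hξ).1, (hs ξ hξ).2.2, hb, (hs ξ hξ).2.1⟩

lemma integral_max {f : ℝ → ℝ → ℝ} {ε c : ℝ} (hε : 0 ≤ ε) (h : ε ≤ c)
    (hd : ∀ η ∈ Icc ε c, f η η = 0) (hf : ContinuousOn (f ε) (Icc 0 ε)) :
    IntervalIntegrable (fun η => f (max ε η) η) volume 0 c ∧
      ∫ η in (0 : ℝ)..c, f (max ε η) η = ∫ η in (0 : ℝ)..ε, f ε η := by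
  have e1 : EqOn (f ε) (fun η => f (max ε η) η) (uIcc 0 ε) := fun η hη => by
    rw [uIcc_of_le hε] at hη
    simp [max_eq_left hη.2]
  have e2 : EqOn (fun _ => (0 : ℝ)) (fun η => f (max ε η) η) (uIcc ε c) := fun η hη => by
    rw [uIcc_of_le h] at hη
    simp [max_eq_right hη.1, hd η hη]
  have i1 : IntervalIntegrable (fun η => f (max ε η) η) volume 0 ε :=
    (hf.intervalIntegrable_of_Icc hε).congr (e1.mono uIoc_subset_uIcc)
  have i2 : IntervalIntegrable (fun η => f (max ε η) η) volume ε c :=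
    (intervalIntegrable_const (c := (0 : ℝ))).congr (e2.mono uIoc_subset_uIcc)
  refine ⟨i1.trans i2, ?_⟩
  rw [← intervalIntegral.integral_add_adjacent_intervals i1 i2,
    intervalIntegral.integral_congr e1, ← intervalIntegral.integral_congr e2]
  simp

/-- The flux density through an outgoing null ray, in terms of `(r u)₊`. -/
noncomputable def ray (u : ℝ → ℝ → ℝ) (b ξ : ℝ) : ℝ := nul (vplus u) ξ b ^ 2 / 2

lemma continuousOn_ray (H : ConeRegular u c) {b : ℝ} (hb : 0 ≤ b) {s : Set ℝ}
    (hs : ∀ ξ ∈ s, 0 < ξ ∧ b ≤ ξ ∧ ξ ≤ c) : ContinuousOn (ray u b) s :=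
  ((H.continuousOn_vplus_col hb hs).pow 2).div_const 2

lemma ray_nonneg (u : ℝ → ℝ → ℝ) (b ξ : ℝ) : 0 ≤ ray u b ξ := by unfold ray; positivity

/-- The energy in the null coordinate slice `ξ = const`. -/
noncomputable def slice (u : ℝ → ℝ → ℝ) (ξ : ℝ) : ℝ :=
  ∫ η in (0 : ℝ)..ξ, (nul (vminus u) ξ η ^ 2 / 2 + npot u ξ η)

/-- The potential energy in the null coordinate slice `ξ = const`. -/
noncomputable def mass (u : ℝ → ℝ → ℝ) (ξ : ℝ) : ℝ := ∫ η in (0 : ℝ)..ξ, npot u ξ η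

lemma mass_le_slice (H : ConeRegular u c) {ξ : ℝ} (h0 : 0 < ξ) (hc : ξ ≤ c) :
    mass u ξ ≤ slice u ξ := by
  have h1 := H.continuousOn_npot_row h0 hc
  have h2 := H.continuousOn_vminus_row h0 hc
  refine intervalIntegral.integral_mono_on h0.le (h1.intervalIntegrable_of_Icc h0.le)
    (ContinuousOn.intervalIntegrable_of_Icc h0.le (by fun_prop)) fun η _ => ?_
  have := sq_nonneg (nul (vminus u) ξ η)
  linarith

lemma slice_add_le (H : ConeRegular u c) {ε c' : ℝ} (hε : 0 < ε) (hεc : ε ≤ c') (hc : c' ≤ c) :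
    slice u ε + ∫ ξ in ε..c', ray u 0 ξ ≤ slice u c' := by
  have hc0 := hε.trans_le hεc
  have key := H.green_cone (k₀ := -1) (k₁ := 0) (k₂ := -1) (C := 0) hc0.le hε hεc le_rfl hc
    le_rfl (fun ξ η _ _ _ _ _ => by simp)
  have c1 := H.continuousOn_npot_row hc0 hc
  have c2 := H.continuousOn_vminus_row hc0 hc
  have d1 := H.continuousOn_npot_row hε (hεc.trans hc)
  have d2 := H.continuousOn_vminus_row hε (hεc.trans hc)
  have i1 : IntervalIntegrable (fun η => nul (vminus u) c' η ^ 2 / 2 + npot u c' η) volume 0 c' :=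
    ContinuousOn.intervalIntegrable_of_Icc hc0.le (by fun_prop)
  obtain ⟨i2, e2⟩ := integral_max (f := fun ξ η => nul (vminus u) ξ η ^ 2 / 2 + npot u ξ η)
    hε.le hεc (fun η hη => by
      simp [H.npot_diag (hε.trans_le hη.1) (hη.2.trans hc),
        H.vminus_diag (hε.trans_le hη.1) (hη.2.trans hc)]) (by fun_prop)
  have e3 : (∫ η in (0 : ℝ)..c', ((-1 * (nul (vminus u) c' η ^ 2 / 2) +
        (-1 + 0 * c') * npot u c' η) - (-1 * (nul (vminus u) (max ε η) η ^ 2 / 2) +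
          (-1 + 0 * max ε η) * npot u (max ε η) η))) = - slice u c' + slice u ε := by
    have : ∀ η, ((-1 * (nul (vminus u) c' η ^ 2 / 2) +
        (-1 + 0 * c') * npot u c' η) - (-1 * (nul (vminus u) (max ε η) η ^ 2 / 2) +
          (-1 + 0 * max ε η) * npot u (max ε η) η)) =
        (nul (vminus u) (max ε η) η ^ 2 / 2 + npot u (max ε η) η) -
        (nul (vminus u) c' η ^ 2 / 2 + npot u c' η) := fun η => by ring
    simp only [this]
    rw [intervalIntegral.integral_sub i2 i1]
    simp only [slice] at e2 ⊢
    rw [e2]; ring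
  have hs : ∀ ξ ∈ Icc ε c', 0 < ξ ∧ 0 ≤ ξ ∧ ξ ≤ c := fun ξ hξ =>
    ⟨hε.trans_le hξ.1, (hε.trans_le hξ.1).le, hξ.2.trans hc⟩
  have e4 : (∫ ξ in ε..c', ray u 0 ξ) ≤
      ∫ ξ in ε..c', (((-1 + 0 * ξ) * (nul (vplus u) ξ (min ξ c') ^ 2 / 2) +
          -1 * npot u ξ (min ξ c')) -
        ((-1 + 0 * ξ) * (nul (vplus u) ξ 0 ^ 2 / 2) + -1 * npot u ξ 0)) := by
    have c3 := H.continuousOn_vplus_col le_rfl hs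
    have c4 := H.continuousOn_npot_col le_rfl hs
    have : (∫ ξ in ε..c', (((-1 + 0 * ξ) * (nul (vplus u) ξ (min ξ c') ^ 2 / 2) +
          -1 * npot u ξ (min ξ c')) -
        ((-1 + 0 * ξ) * (nul (vplus u) ξ 0 ^ 2 / 2) + -1 * npot u ξ 0))) =
        ∫ ξ in ε..c', (ray u 0 ξ + npot u ξ 0) := by
      refine intervalIntegral.integral_congr fun ξ hξ => ?_
      rw [uIcc_of_le hεc] at hξ
      simp only [min_eq_left hξ.2, H.npot_diag (hs ξ hξ).1 (hs ξ hξ).2.2,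
        H.vplus_diag (hs ξ hξ).1 (hs ξ hξ).2.2, ray]
      ring
    rw [this]
    have c5 := H.continuousOn_ray le_rfl hs
    refine intervalIntegral.integral_mono_on hεc (c5.intervalIntegrable_of_Icc hεc)
      (ContinuousOn.intervalIntegrable_of_Icc hεc (by fun_prop)) fun ξ _ => ?_
    linarith [npot_nonneg u ξ 0]
  linarith

lemma slice_nonneg (u : ℝ → ℝ → ℝ) {ξ : ℝ} (h : 0 ≤ ξ) : 0 ≤ slice u ξ :=
  intervalIntegral.integral_nonneg h fun η _ => add_nonneg (by positivity) (npot_nonneg u ξ η)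

lemma intervalIntegrable_ray_zero (H : ConeRegular u c) :
    IntervalIntegrable (ray u 0) volume 0 c := by
  rw [intervalIntegrable_iff_integrableOn_Ioc_of_le H.pos.le]
  have hlim : Tendsto (fun n : ℕ => c * (1 / ((n : ℝ) + 1))) atTop (𝓝 0) := by
    simpa using tendsto_one_div_add_atTop_nhds_zero_nat.const_mul c
  have hpos : ∀ n : ℕ, 0 < c * (1 / ((n : ℝ) + 1)) := fun n => mul_pos H.pos (by positivity)
  have hle : ∀ n : ℕ, c * (1 / ((n : ℝ) + 1)) ≤ c := fun n => by
    refine mul_le_of_le_one_right H.pos.le ?_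
    rw [div_le_one (by positivity)]
    linarith [n.cast_nonneg (α := ℝ)]
  refine integrableOn_Ioc_of_intervalIntegral_norm_bounded_left (I := slice u c) (l := atTop)
    (a := fun n : ℕ => c * (1 / ((n : ℝ) + 1))) (fun n => ?_) hlim
    (Eventually.of_forall fun n => ?_)
  · have := H.continuousOn_ray le_rfl (s := Icc (c * (1 / ((n : ℝ) + 1))) c)
      fun ξ hξ => ⟨(hpos n).trans_le hξ.1, ((hpos n).trans_le hξ.1).le, hξ.2⟩
    exact (this.integrableOn_Icc).mono_set Ioc_subset_Icc_self
  · have h1 := H.slice_add_le (hpos n) (hle n) le_rfl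
    have h2 := slice_nonneg u (hpos n).le
    have : (∫ ξ in c * (1 / ((n : ℝ) + 1))..c, ‖ray u 0 ξ‖) =
        ∫ ξ in c * (1 / ((n : ℝ) + 1))..c, ray u 0 ξ :=
      intervalIntegral.integral_congr fun ξ _ => Real.norm_of_nonneg (ray_nonneg u 0 ξ)
    rw [← intervalIntegral.integral_of_le (hle n), this]
    linarith

lemma add_skew_nonneg {x r : ℝ} (hr : 0 < r) (hr1 : r ≤ 1 / 2) :
    0 ≤ x * nonl x r + skew x ^ 2 / r ^ 3 :=
  nonneg_of_mul_nonneg_right ((by positivity : 0 ≤ skew x ^ 2 / (2 * r ^ 2)).trans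
    (mul_nonl_lower hr hr1)) hr

lemma mul_mass_le (H : ConeRegular u c) {ε c' : ℝ} (hε : 0 < ε) (hεc : ε ≤ c') (hc : c' ≤ c) :
    c' * mass u c' ≤ ε * mass u ε + c' * (∫ ξ in ε..c', ray u 0 ξ) + c' * c' := by
  have hc0 := hε.trans_le hεc
  have key := H.green_cone (k₀ := 0) (k₁ := 1) (k₂ := 0) (C := 1) hc0.le hε hεc le_rfl hc
    zero_le_one (fun ξ η h1 h2 h3 h4 h5 => by
      have hr : 0 < (ξ - η) / 2 := by linarith
      have hr1 : (ξ - η) / 2 ≤ 1 / 2 := by linarith [H.le_one]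
      have m1 := mul_nonl_lower (x := nul u ξ η) hr hr1
      have m2 := mul_le_mul_of_nonneg_right (by linarith : (ξ - η) / 2 ≤ ξ / 2)
        (add_skew_nonneg (x := nul u ξ η) hr hr1)
      have m3 := Real.sin_sq_le_one (nul u ξ η)
      simp only [npot, pot]
      linarith)
  have c1 := H.continuousOn_npot_row hc0 hc
  have d1 := H.continuousOn_npot_row hε (hεc.trans hc)
  have i1 : IntervalIntegrable (fun η => c' * npot u c' η) volume 0 c' :=
    ContinuousOn.intervalIntegrable_of_Icc hc0.le (by fun_prop)
  obtain ⟨i2, e2⟩ := integral_max (f := fun ξ η => ξ * npot u ξ η)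
    hε.le hεc (fun η hη => by
      simp [H.npot_diag (hε.trans_le hη.1) (hη.2.trans hc)]) (by fun_prop)
  have e3 : (∫ η in (0 : ℝ)..c', ((0 * (nul (vminus u) c' η ^ 2 / 2) +
        (0 + 1 * c') * npot u c' η) - (0 * (nul (vminus u) (max ε η) η ^ 2 / 2) +
          (0 + 1 * max ε η) * npot u (max ε η) η))) = c' * mass u c' - ε * mass u ε := by
    simp only [zero_mul, one_mul, zero_add]
    rw [intervalIntegral.integral_sub i1 i2]
    rw [e2]
    simp only [mass, intervalIntegral.integral_const_mul]
  have hs : ∀ ξ ∈ Icc ε c', 0 < ξ ∧ 0 ≤ ξ ∧ ξ ≤ c := fun ξ hξ =>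
    ⟨hε.trans_le hξ.1, (hε.trans_le hξ.1).le, hξ.2.trans hc⟩
  have c5 := H.continuousOn_ray le_rfl hs
  have e4 : (∫ ξ in ε..c', (((0 + 1 * ξ) * (nul (vplus u) ξ (min ξ c') ^ 2 / 2) +
          0 * npot u ξ (min ξ c')) -
        ((0 + 1 * ξ) * (nul (vplus u) ξ 0 ^ 2 / 2) + 0 * npot u ξ 0))) =
        ∫ ξ in ε..c', -(ξ * ray u 0 ξ) := by
    refine intervalIntegral.integral_congr fun ξ hξ => ?_
    rw [uIcc_of_le hεc] at hξ
    simp only [min_eq_left hξ.2, H.vplus_diag (hs ξ hξ).1 (hs ξ hξ).2.2, ray]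
    ring
  have e5 : (∫ ξ in ε..c', ξ * ray u 0 ξ) ≤ c' * ∫ ξ in ε..c', ray u 0 ξ := by
    rw [← intervalIntegral.integral_const_mul]
    refine intervalIntegral.integral_mono_on hεc
      (ContinuousOn.intervalIntegrable_of_Icc hεc (by fun_prop))
      (ContinuousOn.intervalIntegrable_of_Icc hεc (by fun_prop)) fun ξ hξ => ?_
    exact mul_le_mul_of_nonneg_right hξ.2 (ray_nonneg u 0 ξ)
  rw [e3, e4, intervalIntegral.integral_neg] at key
  nlinarith

lemma integral_ray_le_rect (H : ConeRegular u c) {b c' : ℝ} (hb : 0 < b) (hbc : b ≤ c')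
    (hc : c' ≤ c) :
    ∫ ξ in b..c', ray u b ξ ≤ (∫ ξ in b..c', ray u 0 ξ) + mass u b := by
  have hc0 := hb.trans_le hbc
  have key := H.green_cone (k₀ := 1) (k₁ := 0) (k₂ := 0) (C := 0) hb.le hb hbc hbc hc
    le_rfl (fun ξ η h1 h2 h3 h4 h5 => by
      have m2 := add_skew_nonneg (x := nul u ξ η) (r := (ξ - η) / 2) (by linarith)
        (by linarith [H.le_one])
      linarith)
  have c1 := H.continuousOn_npot_row hc0 hc
  have d1 := H.continuousOn_npot_row hb (hbc.trans hc)
  have hsub : Icc 0 b ⊆ Icc 0 c' := Icc_subset_Icc_right hbc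
  have i1 : IntervalIntegrable (fun η => npot u c' η) volume 0 b :=
    ContinuousOn.intervalIntegrable_of_Icc hb.le (c1.mono hsub)
  have i2 : IntervalIntegrable (fun η => npot u b η) volume 0 b :=
    ContinuousOn.intervalIntegrable_of_Icc hb.le d1
  have e3 : (∫ η in (0 : ℝ)..b, ((0 * (nul (vminus u) c' η ^ 2 / 2) +
        (1 + 0 * c') * npot u c' η) - (0 * (nul (vminus u) (max b η) η ^ 2 / 2) +
          (1 + 0 * max b η) * npot u (max b η) η))) =
      (∫ η in (0 : ℝ)..b, npot u c' η) - mass u b := by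
    rw [mass, ← intervalIntegral.integral_sub i1 i2]
    refine intervalIntegral.integral_congr fun η hη => ?_
    rw [uIcc_of_le hb.le] at hη
    simp only [max_eq_left hη.2]
    ring
  have e30 : 0 ≤ ∫ η in (0 : ℝ)..b, npot u c' η :=
    intervalIntegral.integral_nonneg hb.le fun η _ => npot_nonneg u c' η
  have c5 := H.continuousOn_ray (b := 0) le_rfl (s := Icc b c') fun ξ hξ =>
    ⟨hb.trans_le hξ.1, (hb.trans_le hξ.1).le, hξ.2.trans hc⟩
  have c6 := H.continuousOn_ray (b := b) hb.le (s := Icc b c') fun ξ hξ =>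
    ⟨hb.trans_le hξ.1, hξ.1, hξ.2.trans hc⟩
  have e4 : (∫ ξ in b..c', (((1 + 0 * ξ) * (nul (vplus u) ξ (min ξ b) ^ 2 / 2) +
          0 * npot u ξ (min ξ b)) -
        ((1 + 0 * ξ) * (nul (vplus u) ξ 0 ^ 2 / 2) + 0 * npot u ξ 0))) =
        (∫ ξ in b..c', ray u b ξ) - ∫ ξ in b..c', ray u 0 ξ := by
    rw [← intervalIntegral.integral_sub (c6.intervalIntegrable_of_Icc hbc)
      (c5.intervalIntegrable_of_Icc hbc)]
    refine intervalIntegral.integral_congr fun ξ hξ => ?_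
    rw [uIcc_of_le hbc] at hξ
    simp only [min_eq_right hξ.1, ray]
    ring
  rw [e3, e4] at key
  linarith

lemma intervalIntegrable_ray_zero_of_le (H : ConeRegular u c) {a b : ℝ} (ha : 0 ≤ a) (hab : a ≤ b)
    (hb : b ≤ c) : IntervalIntegrable (ray u 0) volume a b := by
  refine H.intervalIntegrable_ray_zero.mono_set ?_
  rw [uIcc_of_le hab, uIcc_of_le H.pos.le]
  exact Icc_subset_Icc ha hb

lemma mass_le (H : ConeRegular u c) {c' : ℝ} (h0 : 0 < c') (hc : c' ≤ c) :
    mass u c' ≤ (∫ ξ in (0 : ℝ)..c', ray u 0 ξ) + c' := by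
  have hlim : Tendsto (fun ε => ε / c' * slice u c + ((∫ ξ in (0 : ℝ)..c', ray u 0 ξ) + c'))
      (𝓝[>] 0) (𝓝 (0 / c' * slice u c + ((∫ ξ in (0 : ℝ)..c', ray u 0 ξ) + c'))) :=
    ((by fun_prop : Continuous fun ε => ε / c' * slice u c +
      ((∫ ξ in (0 : ℝ)..c', ray u 0 ξ) + c')).tendsto 0).mono_left nhdsWithin_le_nhds
  rw [zero_div, zero_mul, zero_add] at hlim
  refine ge_of_tendsto hlim ?_
  filter_upwards [Ioc_mem_nhdsGT h0] with ε hε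
  have m1 := H.mul_mass_le hε.1 hε.2 hc
  have m2 := H.mass_le_slice hε.1 (hε.2.trans hc)
  have m3 := H.slice_add_le hε.1 (hε.2.trans hc) le_rfl
  have m4 : 0 ≤ ∫ ξ in ε..c, ray u 0 ξ :=
    intervalIntegral.integral_nonneg (hε.2.trans hc) fun ξ _ => ray_nonneg u 0 ξ
  have m5 : (∫ ξ in ε..c', ray u 0 ξ) ≤ ∫ ξ in (0 : ℝ)..c', ray u 0 ξ := by
    rw [← intervalIntegral.integral_add_adjacent_intervals
      (H.intervalIntegrable_ray_zero_of_le le_rfl hε.1.le (hε.2.trans hc))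
      (H.intervalIntegrable_ray_zero_of_le hε.1.le hε.2 hc)]
    have : 0 ≤ ∫ ξ in (0 : ℝ)..ε, ray u 0 ξ :=
      intervalIntegral.integral_nonneg hε.1.le fun ξ _ => ray_nonneg u 0 ξ
    linarith
  have m6 : ε * mass u ε ≤ ε * slice u c := mul_le_mul_of_nonneg_left (by linarith) hε.1.le
  have m7 := mul_le_mul_of_nonneg_left m5 h0.le
  have e : c' * (ε / c' * slice u c + ((∫ ξ in (0 : ℝ)..c', ray u 0 ξ) + c')) =
      ε * slice u c + c' * (∫ ξ in (0 : ℝ)..c', ray u 0 ξ) + c' * c' := by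
    field_simp
    ring
  refine le_of_mul_le_mul_left ?_ h0
  linarith

lemma integral_ray_le (H : ConeRegular u c) {b c' : ℝ} (hb : 0 < b) (hbc : b ≤ c')
    (hc : c' ≤ c) :
    ∫ ξ in b..c', ray u b ξ ≤ (∫ ξ in (0 : ℝ)..c', ray u 0 ξ) + b := by
  have h1 := H.integral_ray_le_rect hb hbc hc
  have h2 := H.mass_le hb (hbc.trans hc)
  have h3 := intervalIntegral.integral_add_adjacent_intervals
      (H.intervalIntegrable_ray_zero_of_le le_rfl hb.le (hbc.trans hc))
      (H.intervalIntegrable_ray_zero_of_le hb.le hbc hc)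
  linarith

lemma contDiffAt_cone (H : ConeRegular u c) {b r : ℝ} (hb : 0 ≤ b) (hr : 0 ≤ r)
    (h0 : 0 < 2 * r + b) (hc : 2 * r + b ≤ c) :
    ContDiffAt ℝ (⊤ : ℕ∞) (fun p : ℝ × ℝ => u p.1 p.2) (r + b, r) := by
  have := H.smooth (2 * r + b) b h0 hc hb (by linarith)
  convert this using 2 <;> ring

lemma integral_uplus_le (H : ConeRegular u c) {b δ : ℝ} (hb : 0 < b) (hδ : 0 ≤ δ)
    (hc : 2 * δ + b ≤ c) :
    ∫ r in (0 : ℝ)..δ, uplus u (r + b) r ^ 2 * r ^ 2 ≤ ∫ ξ in b..(2 * δ + b), ray u b ξ := by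
  have hsm : ∀ r ∈ Icc 0 δ, ContDiffAt ℝ (⊤ : ℕ∞) (fun p : ℝ × ℝ => u p.1 p.2) (r + b, r) :=
    fun r hr => H.contDiffAt_cone hb.le hr.1 (by linarith [hr.1]) (by linarith [hr.2])
  have hl : ∀ r : ℝ, ContinuousAt (fun r : ℝ => (r + b, r)) r := fun r => by fun_prop
  have c1 : ContinuousOn (fun r => u (r + b) r) (Icc 0 δ) := fun r hr =>
    (ContinuousAt.comp (f := fun r : ℝ => (r + b, r)) (g := fun p : ℝ × ℝ => u p.1 p.2)
      (hsm r hr).continuousAt (hl r)).continuousWithinAt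
  have c2 : ContinuousOn (fun r => uplus u (r + b) r) (Icc 0 δ) := fun r hr =>
    (ContinuousAt.comp (f := fun r : ℝ => (r + b, r)) (g := fun p : ℝ × ℝ => uplus u p.1 p.2)
      (contDiffAt_uplus (hsm r hr)).continuousAt (hl r)).continuousWithinAt
  have hd : ∀ r ∈ uIcc 0 δ, HasDerivAt (fun r => r * u (r + b) r ^ 2)
      (u (r + b) r ^ 2 + 2 * r * u (r + b) r * uplus u (r + b) r) r := by
    intro r hr
    rw [uIcc_of_le hδ] at hr
    have := (hasDerivAt_id r).mul ((hasDerivAt_along (hsm r hr)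
      ((hasDerivAt_id r).add_const b) (hasDerivAt_id r)).pow 2)
    refine this.congr_deriv ?_
    simp only [uplus, id, Nat.cast_ofNat, Pi.pow_apply]
    ring
  have i1 : IntervalIntegrable
      (fun r => u (r + b) r ^ 2 + 2 * r * u (r + b) r * uplus u (r + b) r) volume 0 δ :=
    ((c1.pow 2).add (((continuousOn_const.mul continuousOn_id).mul c1).mul
      c2)).intervalIntegrable_of_Icc hδ
  have ftc := intervalIntegral.integral_eq_sub_of_hasDerivAt hd i1
  have i2 : IntervalIntegrable (fun r => uplus u (r + b) r ^ 2 * r ^ 2) volume 0 δ :=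
    ContinuousOn.intervalIntegrable_of_Icc hδ (by fun_prop)
  have cv := intervalIntegral.mul_integral_comp_mul_add (a := 0) (b := δ) (f := ray u b) 2 b
  have e : 2 * (∫ r in (0 : ℝ)..δ, ray u b (2 * r + b)) =
      (∫ r in (0 : ℝ)..δ, uplus u (r + b) r ^ 2 * r ^ 2) + ∫ r in (0 : ℝ)..δ,
        (u (r + b) r ^ 2 + 2 * r * u (r + b) r * uplus u (r + b) r) := by
    rw [← intervalIntegral.integral_const_mul, ← intervalIntegral.integral_add i2 i1]
    refine intervalIntegral.integral_congr fun r _ => ?_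
    have a1 : (2 * r + b + b) / 2 = r + b := by ring
    have a2 : (2 * r + b - b) / 2 = r := by ring
    simp only [ray, nul, vplus, a1, a2]
    ring
  rw [mul_zero, zero_add] at cv
  rw [← cv, e, ftc]
  have : 0 ≤ δ * u (δ + b) δ ^ 2 := by positivity
  linarith

lemma exists_integral_uplus_le (H : ConeRegular u c) {ε : ℝ} (hε : 0 < ε) :
    ∃ d, 0 < d ∧ ∀ δ, 0 < δ → δ ≤ d → ∀ t, 0 < t → t ≤ d →
      ∫ r in (0 : ℝ)..δ, uplus u (r + 2 * t) r ^ 2 * r ^ 2 ≤ ε := by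
  have hint : IntegrableOn (ray u 0) (uIcc 0 c) := by
    rw [uIcc_of_le H.pos.le, integrableOn_Icc_iff_integrableOn_Ioc,
      ← intervalIntegrable_iff_integrableOn_Ioc_of_le H.pos.le]
    exact H.intervalIntegrable_ray_zero
  have hcont := (intervalIntegral.continuousOn_primitive_interval hint) 0 left_mem_uIcc
  rw [uIcc_of_le H.pos.le] at hcont
  have hlim : Tendsto (fun x => (∫ ξ in (0 : ℝ)..x, ray u 0 ξ) + x) (𝓝[Icc 0 c] 0) (𝓝 (0 + 0)) :=
    Tendsto.add (by simpa [ContinuousWithinAt] using hcont)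
      (tendsto_id.mono_left nhdsWithin_le_nhds)
  rw [add_zero] at hlim
  obtain ⟨x, hx, hx0, hxc⟩ : ∃ x, (∫ ξ in (0 : ℝ)..x, ray u 0 ξ) + x < ε ∧ 0 < x ∧ x ≤ c := by
    have h1 : Ioc 0 c ∈ 𝓝[>] (0 : ℝ) := Ioc_mem_nhdsGT H.pos
    have h2 : 𝓝[>] (0 : ℝ) ≤ 𝓝[Icc 0 c] 0 := by
      rw [← nhdsWithin_Ioc_eq_nhdsGT H.pos]
      exact nhdsWithin_mono _ Ioc_subset_Icc_self
    obtain ⟨x, hx⟩ := (((hlim.mono_left h2).eventually (gt_mem_nhds hε)).and h1).exists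
    exact ⟨x, hx.1, hx.2⟩
  refine ⟨x / 4, by positivity, fun δ hδ hδd t ht htd => ?_⟩
  have hb : 0 < 2 * t := by positivity
  have hle : 2 * δ + 2 * t ≤ x := by linarith
  have h1 := H.integral_uplus_le hb hδ.le (hle.trans hxc)
  have h2 := H.integral_ray_le hb (by linarith : 2 * t ≤ 2 * δ + 2 * t) (hle.trans hxc)
  have h3 := intervalIntegral.integral_add_adjacent_intervals
      (H.intervalIntegrable_ray_zero_of_le le_rfl (by linarith) (hle.trans hxc))
      (H.intervalIntegrable_ray_zero_of_le (by linarith) hle hxc)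
  have h4 : 0 ≤ ∫ ξ in (2 * δ + 2 * t)..x, ray u 0 ξ :=
    intervalIntegral.integral_nonneg hle fun ξ _ => ray_nonneg u 0 ξ
  linarith

lemma tendsto_integral_of_continuousOn {F : ℝ → ℝ → ℝ} {a ρ : ℝ} (hρ : 0 < ρ) (hρa : ρ ≤ a)
    (hF : ContinuousOn (fun p : ℝ × ℝ => F p.1 p.2) {p | 0 ≤ p.1 ∧ 0 < p.2 ∧ p.1 + p.2 ≤ a})
    {s : ℝ → ℝ} (hs : Continuous s) (hs0 : ρ ≤ s 0 ∧ s 0 ≤ a)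
    (hs1 : ∀ᶠ t in 𝓝[>] (0 : ℝ), ρ ≤ s t ∧ s t ≤ a - t) :
    Tendsto (fun t => ∫ r in ρ..s t, F t r) (𝓝[>] 0) (𝓝 (∫ r in ρ..s 0, F 0 r)) := by
  set τ : ℝ → ℝ := fun t => max 0 (min t (a - ρ)) with hτ
  set σ : ℝ → ℝ → ℝ := fun t r => max ρ (min r (a - τ t)) with hσ
  have hτ0 : ∀ t, 0 ≤ τ t := fun t => le_max_left _ _
  have hτ1 : ∀ t, τ t ≤ a - ρ := fun t => max_le (by linarith) (min_le_right _ _)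
  have hG : Continuous (Function.uncurry fun t r => F (τ t) (σ t r)) := by
    refine hF.comp_continuous (f := fun p : ℝ × ℝ => (τ p.1, σ p.1 p.2)) (by fun_prop) fun p => ?_
    refine ⟨hτ0 _, hρ.trans_le (le_max_left _ _), ?_⟩
    have : σ p.1 p.2 ≤ a - τ p.1 := max_le (by linarith [hτ1 p.1]) (min_le_right _ _)
    show τ p.1 + σ p.1 p.2 ≤ a
    linarith
  have key : ∀ t, 0 ≤ t → ρ ≤ s t → s t ≤ a - t →
      ∫ r in ρ..s t, F (τ t) (σ t r) = ∫ r in ρ..s t, F t r := by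
    intro t ht h1 h2
    have e : τ t = t := by
      simp only [hτ]
      rw [min_eq_left (by linarith), max_eq_right ht]
    refine intervalIntegral.integral_congr fun r hr => ?_
    rw [uIcc_of_le h1] at hr
    have e2 : σ t r = r := by
      simp only [hσ, e]
      rw [min_eq_left (hr.2.trans h2), max_eq_right hr.1]
    simp only [e, e2]
  have hlim := ((intervalIntegral.continuous_parametric_intervalIntegral_of_continuous hG hs
    (a₀ := ρ) (μ := volume)).tendsto 0).mono_left (nhdsWithin_le_nhds (s := Ioi 0))
  rw [key 0 le_rfl hs0.1 (by simpa using hs0.2)] at hlim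
  refine hlim.congr' ?_
  filter_upwards [hs1, self_mem_nhdsWithin] with t ht ht0
  exact key t (le_of_lt ht0) ht.1 ht.2

lemma integrableOn_and_integral_le {f : ℝ → ℝ} {δ ε : ℝ} (hδ : 0 < δ) (hf : ∀ r, 0 ≤ f r)
    (hc : ContinuousOn f (Ioc 0 δ)) (h : ∀ ρ, 0 < ρ → ρ ≤ δ → ∫ r in ρ..δ, f r ≤ ε) :
    IntervalIntegrable f volume 0 δ ∧ ∫ r in (0 : ℝ)..δ, f r ≤ ε := by
  have hlim : Tendsto (fun n : ℕ => δ * (1 / ((n : ℝ) + 1))) atTop (𝓝 0) := by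
    simpa using tendsto_one_div_add_atTop_nhds_zero_nat.const_mul δ
  have hpos : ∀ n : ℕ, 0 < δ * (1 / ((n : ℝ) + 1)) := fun n => mul_pos hδ (by positivity)
  have hle : ∀ n : ℕ, δ * (1 / ((n : ℝ) + 1)) ≤ δ := fun n => by
    refine mul_le_of_le_one_right hδ.le ?_
    rw [div_le_one (by positivity)]
    linarith [n.cast_nonneg (α := ℝ)]
  have hint : IntegrableOn f (Ioc 0 δ) := by
    refine integrableOn_Ioc_of_intervalIntegral_norm_bounded_left (I := ε) (l := atTop)
      (a := fun n : ℕ => δ * (1 / ((n : ℝ) + 1))) (fun n => ?_) hlim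
      (Eventually.of_forall fun n => ?_)
    · have : ContinuousOn f (Icc (δ * (1 / ((n : ℝ) + 1))) δ) :=
        hc.mono fun r hr => ⟨(hpos n).trans_le hr.1, hr.2⟩
      exact (this.integrableOn_Icc).mono_set Ioc_subset_Icc_self
    · have : (∫ r in δ * (1 / ((n : ℝ) + 1))..δ, ‖f r‖) = ∫ r in δ * (1 / ((n : ℝ) + 1))..δ, f r :=
        intervalIntegral.integral_congr fun r _ => Real.norm_of_nonneg (hf r)
      rw [← intervalIntegral.integral_of_le (hle n), this]
      exact h _ (hpos n) (hle n)
  have hI : IntervalIntegrable f volume 0 δ :=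
    (intervalIntegrable_iff_integrableOn_Ioc_of_le hδ.le).2 hint
  refine ⟨hI, ?_⟩
  have hint' : IntegrableOn f (uIcc 0 δ) := by
    rwa [uIcc_of_le hδ.le, integrableOn_Icc_iff_integrableOn_Ioc]
  have hcont := (intervalIntegral.continuousOn_primitive_interval_left hint') 0 left_mem_uIcc
  rw [uIcc_of_le hδ.le] at hcont
  have h2 : 𝓝[>] (0 : ℝ) ≤ 𝓝[Icc 0 δ] 0 := by
    rw [← nhdsWithin_Ioc_eq_nhdsGT hδ]
    exact nhdsWithin_mono _ Ioc_subset_Icc_self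
  refine le_of_tendsto (hcont.tendsto.mono_left h2) ?_
  filter_upwards [Ioc_mem_nhdsGT hδ] with ρ hρ
  exact h ρ hρ.1 hρ.2

/-- Convergence of integrals of a nonnegative family that does not concentrate at `r = 0`. -/
lemma tendsto_integral_of_no_concentration {F : ℝ → ℝ → ℝ} {a : ℝ} (ha : 0 < a)
    (hF0 : ∀ t r, 0 ≤ F t r)
    (hF : ContinuousOn (fun p : ℝ × ℝ => F p.1 p.2) {p | 0 ≤ p.1 ∧ 0 < p.2 ∧ p.1 + p.2 ≤ a})
    (hFt : ∀ t, 0 < t → t < a → ContinuousOn (F t) (Icc 0 (a - t)))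
    (hsmall : ∀ ε, 0 < ε → ∃ d, 0 < d ∧ ∀ δ, 0 < δ → δ ≤ d → ∀ t, 0 < t → t ≤ d →
      ∫ r in (0 : ℝ)..δ, F t r ≤ ε) :
    Tendsto (fun t => ∫ r in (0 : ℝ)..(a - t), F t r) (𝓝[>] 0) (𝓝 (∫ r in (0 : ℝ)..a, F 0 r)) := by
  rw [Metric.tendsto_nhds]
  intro ε hε
  obtain ⟨d, hd, hdle⟩ := hsmall (ε / 4) (by positivity)
  set δ := min d (a / 2) with hδ
  have hδ0 : 0 < δ := lt_min hd (half_pos ha)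
  have hδa : δ < a := (min_le_right _ _).trans_lt (half_lt_self ha)
  have hδd := hdle δ hδ0 (min_le_left _ _)
  have hev : ∀ᶠ t in 𝓝[>] (0 : ℝ), 0 < t ∧ t ≤ d ∧ t < a - δ := by
    filter_upwards [Ioc_mem_nhdsGT hd, Ioo_mem_nhdsGT (sub_pos.2 hδa)] with t h1 h2
    exact ⟨h1.1, h1.2, h2.2⟩
  have hint : ∀ t, 0 < t → ∀ x y, 0 ≤ x → x ≤ y → y ≤ a - t → t < a →
      IntervalIntegrable (F t) volume x y := fun t ht x y hx hxy hy hta =>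
    ((hFt t ht hta).mono (Icc_subset_Icc hx hy)).intervalIntegrable_of_Icc hxy
  have hc0 : ContinuousOn (F 0) (Ioc 0 a) :=
    ContinuousOn.comp (g := fun p : ℝ × ℝ => F p.1 p.2) (f := fun r : ℝ => ((0 : ℝ), r)) hF
      (by fun_prop) fun r hr => ⟨le_rfl, hr.1, by simpa using hr.2⟩
  obtain ⟨hI0, hle0⟩ := integrableOn_and_integral_le (f := F 0) hδ0 (hF0 0)
    (hc0.mono (Ioc_subset_Ioc_right hδa.le)) (ε := ε / 4) fun ρ hρ hρδ => by
      refine le_of_tendsto (tendsto_integral_of_continuousOn (s := fun _ => δ) hρ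
        (hρδ.trans hδa.le) hF continuous_const ⟨hρδ, hδa.le⟩ ?_) ?_
      · filter_upwards [hev] with t ht
        exact ⟨hρδ, by linarith [ht.2.2]⟩
      · filter_upwards [hev] with t ht
        have h1 := hδd t ht.1 ht.2.1
        rw [← intervalIntegral.integral_add_adjacent_intervals
          (hint t ht.1 0 ρ le_rfl hρ.le (by linarith [ht.2.2]) (by linarith [ht.2.2]))
          (hint t ht.1 ρ δ hρ.le hρδ (by linarith [ht.2.2]) (by linarith [ht.2.2]))] at h1
        have : 0 ≤ ∫ r in (0 : ℝ)..ρ, F t r :=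
          intervalIntegral.integral_nonneg hρ.le fun r _ => hF0 t r
        linarith
  have hI1 : IntervalIntegrable (F 0) volume δ a :=
    (hc0.mono fun r hr => ⟨hδ0.trans_le hr.1, hr.2⟩).intervalIntegrable_of_Icc hδa.le
  have hB := tendsto_integral_of_continuousOn (s := fun t => a - t) hδ0 hδa.le hF
    (by fun_prop) ⟨by simpa using hδa.le, by simp⟩ (by
      filter_upwards [hev] with t ht
      exact ⟨by linarith [ht.2.2], le_rfl⟩)
  rw [sub_zero, Metric.tendsto_nhds] at hB
  filter_upwards [hev, hB (ε / 4) (by positivity)] with t ht hBt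
  rw [← intervalIntegral.integral_add_adjacent_intervals hI0 hI1,
    ← intervalIntegral.integral_add_adjacent_intervals
      (hint t ht.1 0 δ le_rfl hδ0.le (by linarith [ht.2.2]) (by linarith [ht.2.2]))
      (hint t ht.1 δ (a - t) hδ0.le (by linarith [ht.2.2]) le_rfl (by linarith [ht.2.2]))]
  have n0 : 0 ≤ ∫ r in (0 : ℝ)..δ, F 0 r :=
    intervalIntegral.integral_nonneg hδ0.le fun r _ => hF0 0 r
  have n1 : 0 ≤ ∫ r in (0 : ℝ)..δ, F t r :=
    intervalIntegral.integral_nonneg hδ0.le fun r _ => hF0 t r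
  have n2 := hδd t ht.1 ht.2.1
  rw [Real.dist_eq, abs_lt] at hBt ⊢
  constructor <;> linarith [hBt.1, hBt.2]

lemma tendsto_integral_uplus (H : ConeRegular u c) {a : ℝ} (ha : 0 < a) (hac : 2 * a ≤ c) :
    Tendsto (fun t => ∫ r in (0 : ℝ)..(a - t), uplus u (r + 2 * t) r ^ 2 * r ^ 2)
      (𝓝[>] 0) (𝓝 (∫ r in (0 : ℝ)..a, uplus u r r ^ 2 * r ^ 2)) := by
  have hat : ∀ t r, 0 ≤ t → 0 ≤ r → 0 < t + r → t + r ≤ a → ContinuousAt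
      (fun p : ℝ × ℝ => uplus u (p.2 + 2 * p.1) p.2 ^ 2 * p.2 ^ 2) (t, r) := by
    intro t r ht hr h0 htr
    have h1 := (contDiffAt_uplus (H.contDiffAt_cone (b := 2 * t) (r := r) (by positivity) hr
      (by linarith) (by linarith))).continuousAt
    have h2 : ContinuousAt (fun p : ℝ × ℝ => (p.2 + 2 * p.1, p.2)) (t, r) := by fun_prop
    have h3 : ContinuousAt (fun p : ℝ × ℝ => uplus u (p.2 + 2 * p.1) p.2) (t, r) :=
      ContinuousAt.comp (f := fun p : ℝ × ℝ => (p.2 + 2 * p.1, p.2))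
        (g := fun p : ℝ × ℝ => uplus u p.1 p.2) h1 h2
    fun_prop
  have := tendsto_integral_of_no_concentration
    (F := fun t r => uplus u (r + 2 * t) r ^ 2 * r ^ 2) ha (fun t r => by positivity)
    (fun p hp => (hat p.1 p.2 hp.1 hp.2.1.le
      (by linarith [hp.1, hp.2.1]) hp.2.2).continuousWithinAt)
    (fun t ht hta r hr => ?_) fun ε hε => H.exists_integral_uplus_le hε
  · simpa using this
  · have h2 : ContinuousAt (fun r : ℝ => (t, r)) r := by fun_prop
    exact (ContinuousAt.comp (f := fun r : ℝ => (t, r))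
      (g := fun p : ℝ × ℝ => uplus u (p.2 + 2 * p.1) p.2 ^ 2 * p.2 ^ 2)
      (hat t r ht.le hr.1 (by linarith [hr.1]) (by linarith [hr.2])) h2).continuousWithinAt
end ConeRegular

namespace BackwardFramework

variable {u : ℝ → ℝ → ℝ} {T : ℝ}

lemma contDiffAt (h : BackwardFramework u T) {t r : ℝ} (hp : (t, r) ∈ Dom T) :
    ContDiffAt ℝ (⊤ : ℕ∞) (fun p : ℝ × ℝ => u p.1 p.2) (t, r) := by
  obtain ⟨-, ⟨V, hV, hDV, hs⟩, -⟩ := h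
  exact hs.contDiffAt (hV.mem_nhds (hDV hp))

lemma mem_Dom {t r : ℝ} (ht : 0 < t) (hr : 0 ≤ r) (hrt : r ≤ t)
    (hT : t + r ≤ 2 * T) : (t, r) ∈ Dom T :=
  ⟨ht, by simp only; linarith, hr, le_min (by simp only; linarith) hrt⟩

lemma eventually_mem_Dom {t : ℝ} (ht : 0 < t) (htT : t ≤ T) :
    ∀ᶠ r in 𝓝[>] (0 : ℝ), 0 < r ∧ (t, r) ∈ Dom T := by
  filter_upwards [Ioc_mem_nhdsGT ht] with r hr
  exact ⟨hr.1, mem_Dom ht hr.1.le hr.2 (by linarith [hr.2])⟩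

lemma continuousAt_axis (h : BackwardFramework u T) {t : ℝ} (ht : 0 < t) (htT : t ≤ T) :
    ContinuousAt (fun r => u t r) 0 ∧ ContinuousAt (fun t => u t 0) t := by
  have hs := (h.contDiffAt (mem_Dom ht le_rfl ht.le (by linarith))).continuousAt
  exact ⟨ContinuousAt.comp (f := fun r : ℝ => (t, r)) (g := fun p : ℝ × ℝ => u p.1 p.2) hs
      (by fun_prop),
    ContinuousAt.comp (f := fun t : ℝ => (t, (0 : ℝ))) (g := fun p : ℝ × ℝ => u p.1 p.2) hs
      (by fun_prop)⟩

lemma sin_axis_eq_zero (h : BackwardFramework u T) {t : ℝ} (ht : 0 < t) (htT : t ≤ T) :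
    Real.sin (u t 0) = 0 := by
  have hs := h.contDiffAt (mem_Dom ht le_rfl ht.le (by linarith))
  have line : ∀ {F : ℝ → ℝ → ℝ},
      ContDiffAt ℝ (⊤ : ℕ∞) (fun p : ℝ × ℝ => F p.1 p.2) (t, 0) →
        ContinuousAt (fun r => F t r) 0 := fun {F} hF =>
    ContinuousAt.comp (f := fun r : ℝ => (t, r)) (g := fun p : ℝ × ℝ => F p.1 p.2)
      hF.continuousAt (by fun_prop)
  have c0 := line hs
  have c1 := line (contDiffAt_ur hs)
  have c2 : ContinuousAt (fun r => utt u t r) 0 :=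
    line (F := ut (ut u)) (contDiffAt_ut (contDiffAt_ut hs))
  have c3 : ContinuousAt (fun r => urr u t r) 0 :=
    line (F := ur (ur u)) (contDiffAt_ur (contDiffAt_ur hs))
  have c4 := continuous_skew.continuousAt.comp (x := (0 : ℝ)) (f := fun r => u t r) c0
  have hc : ContinuousAt (fun r => r ^ 4 * (utt u t r - urr u t r) - 2 * r ^ 3 * ur u t r +
      r ^ 2 * Real.sin (2 * u t r) + skew (u t r) * (1 - Real.cos (2 * u t r))) 0 := by
    have s1 : ContinuousAt (fun r => Real.sin (2 * u t r)) 0 :=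
      Real.continuous_sin.continuousAt.comp (continuousAt_const.mul c0)
    have s2 : ContinuousAt (fun r => Real.cos (2 * u t r)) 0 :=
      Real.continuous_cos.continuousAt.comp (continuousAt_const.mul c0)
    exact (((continuousAt_id.pow 4).mul (c2.sub c3)).sub
      ((continuousAt_const.mul (continuousAt_id.pow 3)).mul c1)).add
      ((continuousAt_id.pow 2).mul s1) |>.add (c4.mul (continuousAt_const.sub s2))
  have hz : ∀ᶠ r in 𝓝[>] (0 : ℝ), r ^ 4 * (utt u t r - urr u t r) - 2 * r ^ 3 * ur u t r +
      r ^ 2 * Real.sin (2 * u t r) + skew (u t r) * (1 - Real.cos (2 * u t r)) = 0 := by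
    filter_upwards [eventually_mem_Dom ht htT] with r hr
    have heq := h.2.2.1 _ hr.2 hr.1
    have hr0 : r ≠ 0 := hr.1.ne'
    unfold ANeq at heq
    unfold skew
    simp only at heq
    field_simp at heq
    linear_combination heq
  have hlim := tendsto_nhds_unique ((hc.tendsto.mono_left nhdsWithin_le_nhds).congr' hz)
    (tendsto_const_nhds (x := (0 : ℝ)))
  simp only [ne_eq, OfNat.ofNat_ne_zero, not_false_eq_true, zero_pow, zero_mul, mul_zero,
    sub_zero, zero_add] at hlim
  rcases mul_eq_zero.1 hlim with h0 | h0
  · rw [eq_zero_of_skew_eq_zero h0, Real.sin_zero]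
  · rw [Real.cos_two_mul] at h0
    have := Real.sin_sq_add_cos_sq (u t 0)
    exact pow_eq_zero_iff (two_ne_zero) |>.1 (by linarith : Real.sin (u t 0) ^ 2 = 0)

lemma terminal_axis_eq_zero (h : BackwardFramework u T) : u T 0 = 0 := by
  by_contra hne
  have hT := h.1
  have hsk : 0 < skew (u T 0) ^ 2 := by
    have : skew (u T 0) ≠ 0 := fun h0 => hne (eq_zero_of_skew_eq_zero h0)
    positivity
  set κ := skew (u T 0) ^ 2 / 4 with hκ
  have hκ0 : 0 < κ := by positivity
  have hc : ContinuousAt (fun r => skew (u T r) ^ 2 / 2) 0 :=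
    ((continuous_skew.continuousAt.comp (x := (0 : ℝ)) (f := fun r => u T r)
      (h.continuousAt_axis hT le_rfl).1).pow 2).div_const 2
  have hev := (hc.tendsto.mono_left (nhdsWithin_le_nhds (s := Ioi 0))).eventually
    (lt_mem_nhds (show κ < skew (u T 0) ^ 2 / 2 by rw [hκ]; linarith))
  obtain ⟨δ, hδ, hsub⟩ := mem_nhdsGT_iff_exists_Ioc_subset.1 hev
  have hδ0 : (0 : ℝ) < δ := hδ
  set d := min (min δ T) 1 with hd
  have hd0 : 0 < d := lt_min (lt_min hδ0 hT) one_pos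
  have hint : IntegrableOn (fun r : ℝ => κ * r⁻¹) (Ioc 0 d) := by
    refine (h.2.2.2.mono_set (Ioc_subset_Ioc_right
      ((min_le_left _ _).trans (min_le_right _ _)))).mono' (by fun_prop) ?_
    refine (ae_restrict_iff' measurableSet_Ioc).2 (Eventually.of_forall fun r hr => ?_)
    have hr1 : r ≤ 1 := hr.2.trans (min_le_right _ _)
    have hr0 := hr.1
    have h1 : κ < skew (u T r) ^ 2 / 2 :=
      hsub ⟨hr.1, hr.2.trans ((min_le_left _ _).trans (min_le_left _ _))⟩
    rw [Real.norm_of_nonneg (by positivity)]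
    have h2 : eDens u T r * r ^ 2 = (1 / 2) * (ut u T r ^ 2 + ur u T r ^ 2) * r ^ 2 +
        Real.sin (u T r) ^ 2 + skew (u T r) ^ 2 / 2 / r ^ 2 := by
      unfold eDens skew; field_simp
    have h3 : κ * r⁻¹ ≤ skew (u T r) ^ 2 / 2 / r ^ 2 := by
      rw [← div_eq_mul_inv, div_le_div_iff₀ hr0 (by positivity)]
      have : r ^ 2 ≤ r := by nlinarith
      have h4 := mul_le_mul h1.le this (by positivity) (by positivity)
      exact h4
    rw [h2]
    have : 0 ≤ (1 / 2) * (ut u T r ^ 2 + ur u T r ^ 2) * r ^ 2 + Real.sin (u T r) ^ 2 := by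
      positivity
    linarith
  have hinv : IntervalIntegrable (fun r : ℝ => r⁻¹) volume 0 d := by
    rw [intervalIntegrable_iff_integrableOn_Ioc_of_le hd0.le]
    have := hint.const_mul κ⁻¹
    refine this.congr (Eventually.of_forall fun r => ?_)
    simp only
    field_simp
  rw [intervalIntegrable_inv_iff] at hinv
  rcases hinv with h0 | h0
  · exact hd0.ne h0
  · exact h0 left_mem_uIcc

lemma axis_eq_zero (h : BackwardFramework u T) {t : ℝ} (ht : 0 < t) (htT : t ≤ T) :
    u t 0 = 0 := by
  by_contra hne
  have hcont : ContinuousOn (fun s => |u s 0|) (Icc t T) := fun s hs =>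
    (h.continuousAt_axis (ht.trans_le hs.1) hs.2).2.abs.continuousWithinAt
  have hpi : Real.pi ≤ |u t 0| := by
    obtain ⟨n, hn⟩ := Real.sin_eq_zero_iff.1 (h.sin_axis_eq_zero ht htT)
    have hn0 : n ≠ 0 := by
      rintro rfl
      exact hne (by simpa using hn.symm)
    rw [← hn, abs_mul, abs_of_pos Real.pi_pos]
    have : (1 : ℝ) ≤ |(n : ℝ)| := by exact_mod_cast Int.one_le_abs hn0
    nlinarith [Real.pi_pos]
  have hmem : Real.pi / 2 ∈ Icc |u T 0| |u t 0| := by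
    rw [h.terminal_axis_eq_zero, abs_zero]
    constructor <;> linarith [Real.pi_pos]
  obtain ⟨s, hs, hsv⟩ := intermediate_value_Icc' htT hcont hmem
  have h1 := h.sin_axis_eq_zero (ht.trans_le hs.1) hs.2
  simp only at hsv
  rcases abs_choice (u s 0) with h2 | h2
  · rw [h2] at hsv
    rw [hsv, Real.sin_pi_div_two] at h1
    exact one_ne_zero h1
  · rw [h2] at hsv
    rw [← neg_neg (u s 0), hsv, Real.sin_neg, Real.sin_pi_div_two] at h1
    norm_num at h1

lemma coneRegular (h : BackwardFramework u T) {c : ℝ} (hc : 0 < c) (hc1 : c ≤ 1) (hcT : c ≤ T) :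
    ConeRegular u c where
  pos := hc
  le_one := hc1
  smooth ξ η h0 hξ hη hle := h.contDiffAt
    (mem_Dom (by linarith) (by linarith) (by linarith) (by linarith))
  eqn ξ η h0 hξ hη hlt := h.2.2.1 ((ξ + η) / 2, (ξ - η) / 2)
    (mem_Dom (by linarith) (by linarith) (by linarith) (by linarith)) (by simp only; linarith)
  axis t ht htc := h.axis_eq_zero ht (htc.trans hcT)

end BackwardFramework

/-- Convergence of the `u₊²` integral on translated forward light cones: for some
`T* ∈ (0, T̄]` and all `0 < t₁ ≤ T*`,
`∫_0^{t₁ - t₀} u₊(r + 2t₀, r)² r² dr → ∫_0^{t₁} u₊(r, r)² r² dr` as `t₀ → 0⁺`. -/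
theorem uplus_cone_convergence (u : ℝ → ℝ → ℝ) (Tbar : ℝ)
    (h : BackwardFramework u Tbar) :
    ∃ Tstar : ℝ, 0 < Tstar ∧ Tstar ≤ Tbar ∧
      ∀ t₁ : ℝ, 0 < t₁ → t₁ ≤ Tstar →
        Tendsto (fun t₀ : ℝ =>
            ∫ r in (0 : ℝ)..(t₁ - t₀), uplus u (r + 2 * t₀) r ^ 2 * r ^ 2)
          (𝓝[>] (0 : ℝ)) (𝓝 (∫ r in (0 : ℝ)..t₁, uplus u r r ^ 2 * r ^ 2)) := by
  have hT := h.1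
  have hc : 0 < min Tbar 1 := lt_min hT one_pos
  have H := h.coneRegular hc (min_le_right _ _) (min_le_left _ _)
  refine ⟨min Tbar 1 / 2, half_pos hc, by linarith [min_le_left Tbar 1], fun t₁ h0 h1 => ?_⟩
  exact H.tendsto_integral_uplus h0 (by linarith)
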